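/- arXiv:0708.2960 — 4 statements merged into one kernel-verified Lean document; each statement's English description precedes it below -/
import Mathlib

section
/- Let (f_0,…,f_5) be a rational solution of A_5(α_0,…,α_5) such that all six rational functions f_0,…,f_5 have a pole at t=∞. Then each f_j has a pole of order one at t=∞ with leading coefficient 1/3, and for every j = 0,…,5, as |t| → ∞, t·(f_j(t) − t/3) → 2α_{j+1} + α_{j+2} − α_{j+4} − 2α_{j+5}. -/
open Filter Topology Polynomial

noncomputable section

/-- Evaluation of a complex rational function at a point (junk value where the
reduced denominator vanishes). -/
def evalR (f : RatFunc ℂ) (t : ℂ) : ℂ := RatFunc.eval (RingHom.id ℂ) t f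

/-- `f` is defined at `t`: the reduced denominator does not vanish at `t`. -/
def DefinedAt (f : RatFunc ℂ) (t : ℂ) : Prop := Polynomial.eval t (RatFunc.denom f) ≠ 0

/-- `(f 0, …, f 5)` is a rational solution of the `A₅⁽¹⁾` Painlevé system `A₅(α)`:
the two constraints hold identically as rational functions, and the six ODEs hold at
every point where all six components are defined.  (Indices are taken in `Fin 6`,
i.e. modulo `6`.) -/
def IsA5Solution (α : Fin 6 → ℂ) (f : Fin 6 → RatFunc ℂ) : Prop :=
  f 0 + f 2 + f 4 = RatFunc.X ∧
  f 1 + f 3 + f 5 = RatFunc.X ∧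
  ∀ t : ℂ, (∀ j : Fin 6, DefinedAt (f j) t) → ∀ i : Fin 6,
    t / 2 * deriv (evalR (f i)) t =
      evalR (f i) t *
        (evalR (f (i + 1)) t * evalR (f (i + 2)) t
          + evalR (f (i + 1)) t * evalR (f (i + 4)) t
          + evalR (f (i + 3)) t * evalR (f (i + 4)) t
          - evalR (f (i + 2)) t * evalR (f (i + 3)) t
          - evalR (f (i + 2)) t * evalR (f (i + 5)) t
          - evalR (f (i + 4)) t * evalR (f (i + 5)) t)
      + (1 / 2 - α (i + 2) - α (i + 4)) * evalR (f i) t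
      + α i * (evalR (f (i + 2)) t + evalR (f (i + 4)) t)

/-- `f` has a pole at `t = ∞`: `‖f t‖ → ∞` as `‖t‖ → ∞`. -/
def PoleAtInfty (f : RatFunc ℂ) : Prop :=
  Tendsto (fun t => ‖evalR f t‖) (Bornology.cobounded ℂ) atTop

/-- `f` is holomorphic at `t = ∞`: `f` is bounded as `‖t‖ → ∞`. -/
def HoloAtInfty (f : RatFunc ℂ) : Prop :=
  IsBoundedUnder (· ≤ ·) (Bornology.cobounded ℂ) fun t => ‖evalR f t‖

/-- `f` has a pole at `c ∈ ℂ`: `‖f t‖ → ∞` as `t → c`. -/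
def PoleAt (f : RatFunc ℂ) (c : ℂ) : Prop :=
  Tendsto (fun t => ‖evalR f t‖) (𝓝[≠] c) atTop

/-- `f` is regular at `c ∈ ℂ`: it extends continuously to `c`. -/
def RegularAt (f : RatFunc ℂ) (c : ℂ) : Prop :=
  ∃ L : ℂ, Tendsto (fun t => evalR f t) (𝓝[≠] c) (𝓝 L)

/-- `z` is an integer. -/
def IsInt (z : ℂ) : Prop := ∃ n : ℤ, z = (n : ℂ)

/-- `z` is an even integer. -/
def IsEvenInt (z : ℂ) : Prop := ∃ n : ℤ, z = 2 * (n : ℂ)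

/-- A tuple of rational functions has pole configuration of Type A at `t = ∞`. -/
def TypeA (f : Fin 6 → RatFunc ℂ) : Prop :=
  ∃ i : Fin 6,
    (PoleAtInfty (f i) ∧ PoleAtInfty (f (i + 1)) ∧ HoloAtInfty (f (i + 2)) ∧
      HoloAtInfty (f (i + 3)) ∧ HoloAtInfty (f (i + 4)) ∧ HoloAtInfty (f (i + 5))) ∨
    (PoleAtInfty (f i) ∧ PoleAtInfty (f (i + 3)) ∧ HoloAtInfty (f (i + 1)) ∧
      HoloAtInfty (f (i + 2)) ∧ HoloAtInfty (f (i + 4)) ∧ HoloAtInfty (f (i + 5))) ∨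
    (PoleAtInfty (f i) ∧ PoleAtInfty (f (i + 1)) ∧ PoleAtInfty (f (i + 2)) ∧
      PoleAtInfty (f (i + 4)) ∧ HoloAtInfty (f (i + 3)) ∧ HoloAtInfty (f (i + 5)))

/-- A tuple of rational functions has pole configuration of Type B at `t = ∞`. -/
def TypeB (f : Fin 6 → RatFunc ℂ) : Prop :=
  ∃ i : Fin 6,
    PoleAtInfty (f i) ∧ PoleAtInfty (f (i + 1)) ∧ PoleAtInfty (f (i + 2)) ∧
    PoleAtInfty (f (i + 3)) ∧ HoloAtInfty (f (i + 4)) ∧ HoloAtInfty (f (i + 5))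


open Asymptotics Bornology

section RationalAtInfinity

lemma Polynomial.tendsto_eval_div_pow_cobounded (p : ℂ[X]) :
    Tendsto (fun t => p.eval t / t ^ p.natDegree) (cobounded ℂ) (𝓝 p.leadingCoeff) := by
  have h : Tendsto (fun t : ℂ => p.reverse.eval t⁻¹) (cobounded ℂ) (𝓝 (p.reverse.eval 0)) :=
    (p.reverse.continuous.tendsto 0).comp tendsto_inv₀_cobounded
  rw [← coeff_zero_eq_eval_zero, coeff_zero_reverse] at h
  refine h.congr' ?_
  filter_upwards [eventually_ne_cobounded (0 : ℂ)] with t ht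
  have := invertibleOfNonzero ht
  have key := eval₂_reverse_mul_pow (RingHom.id ℂ) t p
  rw [invOf_eq_inv] at key
  rw [eq_div_iff (pow_ne_zero _ ht)]
  exact key

lemma Polynomial.eventually_eval_ne_zero_cobounded {p : ℂ[X]} (hp : p ≠ 0) :
    ∀ᶠ t in cobounded ℂ, p.eval t ≠ 0 := by
  filter_upwards [p.tendsto_eval_div_pow_cobounded.eventually_ne (leadingCoeff_ne_zero.2 hp)]
    with t ht h
  simp [h] at ht

lemma tendsto_div_sub_cobounded (r : ℂ) :
    Tendsto (fun t : ℂ => t / (t - r)) (cobounded ℂ) (𝓝 1) := by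
  have h : Tendsto (fun t : ℂ => (1 - r * t⁻¹)⁻¹) (cobounded ℂ) (𝓝 (1 - r * 0)⁻¹) :=
    ((tendsto_inv₀_cobounded.const_mul r).const_sub 1).inv₀ (by simp)
  simp only [mul_zero, sub_zero, inv_one] at h
  refine h.congr' ?_
  filter_upwards [eventually_ne_cobounded (0 : ℂ)] with t ht
  rw [← div_eq_mul_inv, one_sub_div ht, inv_div]

lemma Polynomial.tendsto_mul_derivative_div_cobounded {p : ℂ[X]} (hp : p ≠ 0) :
    Tendsto (fun t => t * p.derivative.eval t / p.eval t) (cobounded ℂ) (𝓝 p.natDegree) := by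
  have hs : p.Splits := IsAlgClosed.splits p
  have h : Tendsto (fun t : ℂ => (p.roots.map fun r => t / (t - r)).sum) (cobounded ℂ)
      (𝓝 (p.roots.map fun _ => (1 : ℂ)).sum) :=
    tendsto_multiset_sum _ fun r _ => tendsto_div_sub_cobounded r
  have hc : (p.roots.map fun _ => (1 : ℂ)).sum = p.natDegree := by
    simp [hs.natDegree_eq_card_roots]
  rw [hc] at h
  refine h.congr' ?_
  filter_upwards [eventually_eval_ne_zero_cobounded hp] with t ht
  rw [mul_div_assoc, hs.eval_derivative_div_eval_of_ne_zero ht, ← Multiset.sum_map_mul_left]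
  simp [div_eq_mul_inv]

lemma evalR_eq_div (f : RatFunc ℂ) (t : ℂ) :
    evalR f t = f.num.eval t / f.denom.eval t := rfl

lemma eventually_definedAt (f : RatFunc ℂ) : ∀ᶠ t in cobounded ℂ, DefinedAt f t :=
  eventually_eval_ne_zero_cobounded f.denom_ne_zero

lemma eventually_evalR_add (f g : RatFunc ℂ) :
    ∀ᶠ t in cobounded ℂ, evalR (f + g) t = evalR f t + evalR g t := by
  filter_upwards [eventually_definedAt f, eventually_definedAt g] with t hf hg
  exact RatFunc.eval_add (RingHom.id ℂ) t hf hg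

lemma eventually_add_add_eq {f g h : RatFunc ℂ} (hX : f + g + h = RatFunc.X) :
    ∀ᶠ t in cobounded ℂ, evalR f t + evalR g t + evalR h t = t := by
  filter_upwards [eventually_evalR_add (f + g) h, eventually_evalR_add f g] with t h1 h2
  rw [← h2, ← h1, hX]
  exact RatFunc.eval_X (RingHom.id ℂ) t

lemma tendsto_mul_deriv_div {f : RatFunc ℂ} (hf : f ≠ 0) :
    Tendsto (fun t => t * deriv (evalR f) t / evalR f t) (cobounded ℂ)
      (𝓝 (f.num.natDegree - f.denom.natDegree)) := by
  have hn : f.num ≠ 0 := RatFunc.num_ne_zero hf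
  refine ((tendsto_mul_derivative_div_cobounded hn).sub
    (tendsto_mul_derivative_div_cobounded f.denom_ne_zero)).congr' ?_
  filter_upwards [eventually_eval_ne_zero_cobounded hn,
    eventually_eval_ne_zero_cobounded f.denom_ne_zero] with t h1 h2
  have hd : deriv (evalR f) t = _ := ((f.num.hasDerivAt t).div (f.denom.hasDerivAt t) h2).deriv
  rw [hd, evalR_eq_div]
  field_simp

/-- Growth of a rational function with a pole at infinity, of order `k + 1`. -/
lemma PoleAtInfty.exists_order {f : RatFunc ℂ} (hf : PoleAtInfty f) :
    ∃ (k : ℕ) (c : ℂ), c ≠ 0 ∧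
      Tendsto (fun t => t * deriv (evalR f) t / evalR f t) (cobounded ℂ) (𝓝 (k + 1)) ∧
      Tendsto (fun t => evalR f t / t ^ (k + 1)) (cobounded ℂ) (𝓝 c) := by
  have hf0 : f ≠ 0 := by
    rintro rfl
    have h0 : Tendsto (fun _ : ℂ => (0 : ℝ)) (cobounded ℂ) atTop := by
      simpa [PoleAtInfty, evalR] using hf
    exact not_tendsto_const_atTop _ _ h0
  set n := f.num.natDegree with hn
  set m := f.denom.natDegree with hm
  have hlc : f.num.leadingCoeff / f.denom.leadingCoeff ≠ 0 :=
    div_ne_zero (leadingCoeff_ne_zero.2 (RatFunc.num_ne_zero hf0))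
      (leadingCoeff_ne_zero.2 f.denom_ne_zero)
  have hq := f.num.tendsto_eval_div_pow_cobounded.div f.denom.tendsto_eval_div_pow_cobounded
    (leadingCoeff_ne_zero.2 f.denom_ne_zero)
  have hlt : m < n := by
    by_contra! hle
    obtain ⟨l, hl⟩ := Nat.exists_eq_add_of_le hle
    have hb : Tendsto (evalR f) (cobounded ℂ)
        (𝓝 (f.num.leadingCoeff / f.denom.leadingCoeff * 0 ^ l)) := by
      refine (hq.mul (tendsto_inv₀_cobounded.pow l)).congr' ?_
      filter_upwards [eventually_ne_cobounded (0 : ℂ),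
        eventually_eval_ne_zero_cobounded f.denom_ne_zero] with t ht h2
      simp only [Pi.div_apply, ← hn, ← hm, hl, evalR_eq_div, inv_pow, pow_add]
      field_simp
    exact not_tendsto_nhds_of_tendsto_atTop hf _ hb.norm
  obtain ⟨k, hk⟩ := Nat.exists_eq_add_of_lt hlt
  refine ⟨k, _, hlc, ?_, hq.congr' ?_⟩
  · convert tendsto_mul_deriv_div hf0 using 2
    rw [← hn, ← hm, hk]
    push_cast
    ring
  · filter_upwards [eventually_ne_cobounded (0 : ℂ),
      eventually_eval_ne_zero_cobounded f.denom_ne_zero] with t ht h2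
    simp only [Pi.div_apply, ← hn, ← hm, hk, evalR_eq_div, pow_add]
    field_simp

lemma PoleAtInfty.eventually_ne_zero {f : RatFunc ℂ} (hf : PoleAtInfty f) :
    ∀ᶠ t in cobounded ℂ, evalR f t ≠ 0 := by
  filter_upwards [hf.eventually_gt_atTop 0] with t ht
  exact norm_pos_iff.1 ht

lemma PoleAtInfty.isBigO_id_div {f : RatFunc ℂ} (hf : PoleAtInfty f) :
    (fun t => t / evalR f t) =O[cobounded ℂ] (fun _ => (1 : ℂ)) := by
  obtain ⟨k, c, hc, -, hlim⟩ := hf.exists_order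
  refine (((tendsto_inv₀_cobounded.pow k).mul (hlim.inv₀ hc)).congr' ?_).isBigO_one ℂ
  filter_upwards [eventually_ne_cobounded (0 : ℂ)] with t ht
  simp only [inv_pow, pow_succ]
  field_simp

lemma PoleAtInfty.tendsto_mul_deriv_div_one {f : RatFunc ℂ} (hf : PoleAtInfty f) {a : ℂ}
    (ha : Tendsto (fun t => evalR f t / t) (cobounded ℂ) (𝓝 a)) :
    Tendsto (fun t => t * deriv (evalR f) t / evalR f t) (cobounded ℂ) (𝓝 1) := by
  obtain ⟨k, c, hc, hd, hlim⟩ := hf.exists_order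
  rcases Nat.eq_zero_or_pos k with rfl | hk
  · simpa using hd
  · have h0 : Tendsto (fun t => evalR f t / t ^ (k + 1)) (cobounded ℂ) (𝓝 (a * 0 ^ k)) := by
      refine (ha.mul (tendsto_inv₀_cobounded.pow k)).congr' ?_
      filter_upwards [eventually_ne_cobounded (0 : ℂ)] with t ht
      simp only [inv_pow, pow_succ]
      field_simp
    have := tendsto_nhds_unique hlim h0
    simp [hk.ne', hc] at this

end RationalAtInfinity

section QuadraticPart

/-- The quadratic cofactor of `f i` in the `i`-th equation of the system. -/
def quadPart (f : Fin 6 → RatFunc ℂ) (i : Fin 6) (t : ℂ) : ℂ :=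
  evalR (f (i + 1)) t * evalR (f (i + 2)) t
    + evalR (f (i + 1)) t * evalR (f (i + 4)) t
    + evalR (f (i + 3)) t * evalR (f (i + 4)) t
    - evalR (f (i + 2)) t * evalR (f (i + 3)) t
    - evalR (f (i + 2)) t * evalR (f (i + 5)) t
    - evalR (f (i + 4)) t * evalR (f (i + 5)) t

variable {α : Fin 6 → ℂ} {f : Fin 6 → RatFunc ℂ}

lemma IsA5Solution.eventually_sum_eq (hsol : IsA5Solution α f) (i : Fin 6) :
    ∀ᶠ t in cobounded ℂ,
      evalR (f i) t + evalR (f (i + 2)) t + evalR (f (i + 4)) t = t := by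
  have h0 := hsol.1
  have h1 := hsol.2.1
  apply eventually_add_add_eq
  fin_cases i
  · exact h0
  · exact h1
  · exact (by ring : f 2 + f 4 + f 0 = f 0 + f 2 + f 4).trans h0
  · exact (by ring : f 3 + f 5 + f 1 = f 1 + f 3 + f 5).trans h1
  · exact (by ring : f 4 + f 0 + f 2 = f 0 + f 2 + f 4).trans h0
  · exact (by ring : f 5 + f 1 + f 3 = f 1 + f 3 + f 5).trans h1

/-- The equation for `f i`, divided by `f i`. -/
lemma IsA5Solution.eventually_quadPart_eq (hsol : IsA5Solution α f)
    (hpoles : ∀ j, PoleAtInfty (f j)) (i : Fin 6) :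
    ∀ᶠ t in cobounded ℂ,
      1 / 2 * (t * deriv (evalR (f i)) t / evalR (f i) t) - α i * (t / evalR (f i) t)
        + (α i + α (i + 2) + α (i + 4) - 1 / 2) = quadPart f i t := by
  filter_upwards [eventually_all.2 fun j => eventually_definedAt (f j),
    hsol.eventually_sum_eq i, (hpoles i).eventually_ne_zero] with t hdef hs hne
  have hode := hsol.2.2 t hdef i
  change _ = evalR (f i) t * quadPart f i t + _ + _ at hode
  field_simp
  linear_combination 2 * hode + 2 * α i * hs

lemma IsA5Solution.eventually_quadPart_sub (hsol : IsA5Solution α f) (i : Fin 6) :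
    ∀ᶠ t in cobounded ℂ, quadPart f i t - quadPart f (i + 2) t
      = t * (evalR (f (i + 4)) t + 2 * evalR (f (i + 1)) t - t) := by
  filter_upwards [hsol.eventually_sum_eq i, hsol.eventually_sum_eq (i + 1)] with t h0 h1
  simp only [quadPart, add_assoc i, Fin.reduceAdd, add_zero] at h0 h1 ⊢
  linear_combination
    (evalR (f (i + 1)) t - evalR (f (i + 3)) t - evalR (f (i + 5)) t) * h0
      - (t - evalR (f (i + 4)) t) * h1

lemma IsA5Solution.eventually_deviation_eq (hsol : IsA5Solution α f) (j : Fin 6) :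
    ∀ᶠ t in cobounded ℂ,
      (2 * (quadPart f (j + 5) t - quadPart f (j + 1) t)
        - (quadPart f (j + 2) t - quadPart f (j + 4) t)) / 3
      = t * (evalR (f j) t - t / 3) := by
  filter_upwards [hsol.eventually_quadPart_sub (j + 5), hsol.eventually_quadPart_sub (j + 2)]
    with t h0 h1
  simp only [add_assoc j, Fin.reduceAdd, add_zero] at h0 h1
  linear_combination 2 / 3 * h0 - 1 / 3 * h1

lemma IsA5Solution.isBigO_quadPart (hsol : IsA5Solution α f)
    (hpoles : ∀ j, PoleAtInfty (f j)) (i : Fin 6) :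
    quadPart f i =O[cobounded ℂ] (fun _ => (1 : ℂ)) := by
  obtain ⟨k, c, -, hd, -⟩ := (hpoles i).exists_order
  refine IsBigO.congr' ?_ (hsol.eventually_quadPart_eq hpoles i) EventuallyEq.rfl
  exact (((hd.isBigO_one ℂ).const_mul_left _).sub
    ((hpoles i).isBigO_id_div.const_mul_left _)).add (isBigO_const_const _ one_ne_zero _)

lemma IsA5Solution.tendsto_div_id (hsol : IsA5Solution α f)
    (hpoles : ∀ j, PoleAtInfty (f j)) (j : Fin 6) :
    Tendsto (fun t => evalR (f j) t / t) (cobounded ℂ) (𝓝 (1 / 3)) := by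
  have hQ := hsol.isBigO_quadPart hpoles
  have hdev : (fun t => t * (evalR (f j) t - t / 3)) =O[cobounded ℂ] (fun _ => (1 : ℂ)) := by
    refine IsBigO.congr' ?_ (hsol.eventually_deviation_eq j) EventuallyEq.rfl
    simp only [div_eq_inv_mul]
    exact ((((hQ _).sub (hQ _)).const_mul_left 2).sub ((hQ _).sub (hQ _))).const_mul_left _
  have hinv : Tendsto (fun t : ℂ => t⁻¹ ^ 2) (cobounded ℂ) (𝓝 0) := by
    simpa using (tendsto_inv₀_cobounded (α := ℂ)).pow 2
  have h0 : Tendsto (fun t => t * (evalR (f j) t - t / 3) * t⁻¹ ^ 2) (cobounded ℂ) (𝓝 0) := by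
    refine (hdev.mul (isBigO_refl _ _)).trans_tendsto ?_
    simpa using hinv
  have h1 := h0.add_const (1 / 3 : ℂ)
  rw [zero_add] at h1
  refine h1.congr' ?_
  filter_upwards [eventually_ne_cobounded (0 : ℂ)] with t ht
  field_simp
  ring

lemma IsA5Solution.tendsto_quadPart (hsol : IsA5Solution α f)
    (hpoles : ∀ j, PoleAtInfty (f j)) (i : Fin 6) :
    Tendsto (quadPart f i) (cobounded ℂ) (𝓝 (α (i + 2) + α (i + 4) - 2 * α i)) := by
  have hdiv := hsol.tendsto_div_id hpoles i
  have hinv : Tendsto (fun t => t / evalR (f i) t) (cobounded ℂ) (𝓝 3) := by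
    simpa using hdiv.inv₀ (by norm_num)
  have h := ((((hpoles i).tendsto_mul_deriv_div_one hdiv).const_mul (1 / 2)).sub
    (hinv.const_mul (α i))).add_const (α i + α (i + 2) + α (i + 4) - 1 / 2)
  convert h.congr' (hsol.eventually_quadPart_eq hpoles i) using 2
  ring

end QuadraticPart

/-- Laurent behaviour at `t = ∞` for a Type C rational solution: every component has a
pole of order one with leading coefficient `1/3`, with the stated next coefficient. -/
theorem stmt_12 (α : Fin 6 → ℂ) (f : Fin 6 → RatFunc ℂ)
    (hsum : α 0 + α 1 + α 2 + α 3 + α 4 + α 5 = 1)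
    (hsol : IsA5Solution α f)
    (hpoles : ∀ j : Fin 6, PoleAtInfty (f j)) :
    ∀ j : Fin 6,
      Tendsto (fun t => t * (evalR (f j) t - t / 3)) (Bornology.cobounded ℂ)
        (𝓝 (2 * α (j + 1) + α (j + 2) - α (j + 4) - 2 * α (j + 5))) := by
  intro j
  have hQ := hsol.tendsto_quadPart hpoles
  have h := ((((hQ (j + 5)).sub (hQ (j + 1))).const_mul 2).sub
    ((hQ (j + 2)).sub (hQ (j + 4)))).div_const 3
  convert h.congr' (hsol.eventually_deviation_eq j) using 2
  simp only [add_assoc j, Fin.reduceAdd, add_zero]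
  ring
end
end

section
/- Fix parameters α_0,…,α_5 with α_0+α_1+α_2+α_3+α_4+α_5 = 1. If (f_0,…,f_5) and (g_0,…,g_5) are both rational solutions of A_5(α_0,…,α_5) such that all six components of each tuple have a pole at t=∞, then f_j = g_j for all j = 0,…,5. -/
open Filter Topology Polynomial

noncomputable section

/-- `f` has degree at most `n` at infinity; the zero function satisfies this for every `n`. -/
def DegLE (n : ℤ) (f : RatFunc ℂ) : Prop := f = 0 ∨ f.intDegree ≤ n

namespace DegLE

variable {m n : ℤ} {f g : RatFunc ℂ}

lemma mono (hf : DegLE m f) (h : m ≤ n) : DegLE n f :=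
  hf.imp_right fun hf => hf.trans h

lemma add (hf : DegLE n f) (hg : DegLE n g) : DegLE n (f + g) := by
  by_cases hg0 : g = 0
  · simpa [hg0] using hf
  by_cases hfg : f + g = 0
  · exact Or.inl hfg
  rcases hf with rfl | hf
  · simpa using hg
  · exact Or.inr ((RatFunc.intDegree_add_le hg0 hfg).trans
      (max_le hf (hg.resolve_left hg0)))

lemma neg (hf : DegLE n f) : DegLE n (-f) := by
  rcases hf with rfl | hf
  · exact Or.inl neg_zero
  · exact Or.inr (by rwa [RatFunc.intDegree_neg])

lemma sub (hf : DegLE n f) (hg : DegLE n g) : DegLE n (f - g) := by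
  rw [sub_eq_add_neg]
  exact hf.add hg.neg

lemma mul (hf : DegLE m f) (hg : DegLE n g) : DegLE (m + n) (f * g) := by
  by_cases hf0 : f = 0
  · exact Or.inl (by simp [hf0])
  by_cases hg0 : g = 0
  · exact Or.inl (by simp [hg0])
  refine Or.inr ?_
  rw [RatFunc.intDegree_mul hf0 hg0]
  exact add_le_add (hf.resolve_left hf0) (hg.resolve_left hg0)

lemma const (c : ℂ) : DegLE 0 (RatFunc.C c) := Or.inr (by simp)

lemma const_mul (c : ℂ) (hf : DegLE n f) : DegLE n (RatFunc.C c * f) := by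
  simpa using (const c).mul hf

lemma var : DegLE 1 (RatFunc.X : RatFunc ℂ) := Or.inr (by simp)

lemma of_X_mul (h : DegLE n (RatFunc.X * f)) : DegLE (n - 1) f := by
  have hX : DegLE (-1) (RatFunc.X⁻¹ : RatFunc ℂ) := Or.inr (by simp [RatFunc.intDegree_inv])
  have := hX.mul h
  rw [inv_mul_cancel_left₀ RatFunc.X_ne_zero] at this
  exact this.mono (by omega)

end DegLE

/-- The formal derivative of a rational function. -/
def ratDeriv (f : RatFunc ℂ) : RatFunc ℂ :=
  algebraMap ℂ[X] (RatFunc ℂ) (derivative f.num * f.denom - f.num * derivative f.denom) /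
    algebraMap ℂ[X] (RatFunc ℂ) (f.denom ^ 2)

lemma ratDeriv_eq_of_eq_div {f : RatFunc ℂ} {p q : ℂ[X]} (hq : q ≠ 0)
    (hf : f = algebraMap ℂ[X] (RatFunc ℂ) p / algebraMap ℂ[X] (RatFunc ℂ) q) :
    ratDeriv f = algebraMap ℂ[X] (RatFunc ℂ) (derivative p * q - p * derivative q) /
      algebraMap ℂ[X] (RatFunc ℂ) (q ^ 2) := by
  have h : f.num * q = p * f.denom := (RatFunc.num_mul_eq_mul_denom_iff hq).mpr hf
  have h' := congrArg derivative h
  simp only [derivative_mul] at h'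
  have hpoly : (derivative f.num * f.denom - f.num * derivative f.denom) * q ^ 2 =
      (derivative p * q - p * derivative q) * f.denom ^ 2 := by
    linear_combination (q * f.denom) * h' - (derivative f.denom * q + f.denom * derivative q) * h
  rw [ratDeriv, div_eq_div_iff (RatFunc.algebraMap_ne_zero (pow_ne_zero 2 f.denom_ne_zero))
    (RatFunc.algebraMap_ne_zero (pow_ne_zero 2 hq)), ← map_mul, ← map_mul, hpoly]

lemma ratDeriv_add (f g : RatFunc ℂ) : ratDeriv (f + g) = ratDeriv f + ratDeriv g := by
  have hf := RatFunc.algebraMap_ne_zero f.denom_ne_zero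
  have hg := RatFunc.algebraMap_ne_zero g.denom_ne_zero
  have h : f + g = algebraMap ℂ[X] (RatFunc ℂ) (f.num * g.denom + f.denom * g.num) /
      algebraMap ℂ[X] (RatFunc ℂ) (f.denom * g.denom) := by
    conv_lhs => rw [← f.num_div_denom, ← g.num_div_denom]
    rw [div_add_div _ _ hf hg]
    simp only [map_add, map_mul]
  rw [ratDeriv_eq_of_eq_div (mul_ne_zero f.denom_ne_zero g.denom_ne_zero) h, ratDeriv, ratDeriv]
  simp only [derivative_mul, map_add, map_sub, map_mul, map_pow]
  field_simp
  ring

lemma DegLE.ratDeriv {n : ℤ} {f : RatFunc ℂ} (hf : DegLE n f) : DegLE (n - 1) (ratDeriv f) := by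
  have hd := f.denom_ne_zero
  by_cases hN : derivative f.num * f.denom - f.num * derivative f.denom = 0
  · exact Or.inl (by simp [_root_.ratDeriv, hN])
  have hn : f.num ≠ 0 := by
    intro h
    simp [h] at hN
  have hlt : (derivative f.num * f.denom - f.num * derivative f.denom).degree <
      (f.num * f.denom).degree := by
    refine (degree_sub_le _ _).trans_lt (max_lt ?_ ?_)
    · rw [degree_mul, degree_mul]
      exact WithBot.add_lt_add_right (degree_ne_bot.mpr hd) (degree_derivative_lt hn)
    · rw [degree_mul, degree_mul]
      exact WithBot.add_lt_add_left (degree_ne_bot.mpr hn) (degree_derivative_lt hd)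
  have hnat := natDegree_lt_natDegree hN hlt
  rw [natDegree_mul hn hd] at hnat
  have hfn : f.intDegree ≤ n := hf.resolve_left fun h => hn (by simp [h])
  refine Or.inr ?_
  rw [_root_.ratDeriv, RatFunc.intDegree_div (RatFunc.algebraMap_ne_zero hN)
    (RatFunc.algebraMap_ne_zero (pow_ne_zero 2 hd)), RatFunc.intDegree_polynomial,
    RatFunc.intDegree_polynomial, natDegree_pow]
  rw [RatFunc.intDegree] at hfn
  push_cast
  omega

/-- `f` is defined at `t`, with value `z`. -/
def HasEval (f : RatFunc ℂ) (t z : ℂ) : Prop := DefinedAt f t ∧ evalR f t = z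

namespace HasEval

variable {f g : RatFunc ℂ} {t x y : ℂ}

lemma of_definedAt (h : DefinedAt f t) : HasEval f t (evalR f t) := ⟨h, rfl⟩

lemma add (hf : HasEval f t x) (hg : HasEval g t y) : HasEval (f + g) t (x + y) := by
  obtain ⟨hf, rfl⟩ := hf
  obtain ⟨hg, rfl⟩ := hg
  refine ⟨fun h => ?_, RatFunc.eval_add (RingHom.id ℂ) t hf hg⟩
  have := eval_eq_zero_of_dvd_of_eval_eq_zero (RatFunc.denom_add_dvd f g) h
  rw [eval_mul] at this
  exact mul_ne_zero hf hg this

lemma mul (hf : HasEval f t x) (hg : HasEval g t y) : HasEval (f * g) t (x * y) := by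
  obtain ⟨hf, rfl⟩ := hf
  obtain ⟨hg, rfl⟩ := hg
  refine ⟨fun h => ?_, RatFunc.eval_mul (RingHom.id ℂ) t hf hg⟩
  have := eval_eq_zero_of_dvd_of_eval_eq_zero (RatFunc.denom_mul_dvd f g) h
  rw [eval_mul] at this
  exact mul_ne_zero hf hg this

lemma const (c : ℂ) : HasEval (RatFunc.C c) t c := ⟨by simp [DefinedAt], by simp [evalR]⟩

lemma var : HasEval RatFunc.X t t := ⟨by simp [DefinedAt], by simp [evalR]⟩

lemma sub (hf : HasEval f t x) (hg : HasEval g t y) : HasEval (f - g) t (x - y) := by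
  have := hf.add ((const (-1)).mul hg)
  simpa [sub_eq_add_neg] using this

lemma div {p q : ℂ[X]} (hq : q.eval t ≠ 0) :
    HasEval (algebraMap ℂ[X] (RatFunc ℂ) p / algebraMap ℂ[X] (RatFunc ℂ) q) t
      (p.eval t / q.eval t) := by
  have hq0 : q ≠ 0 := by
    rintro rfl
    simp at hq
  set f := algebraMap ℂ[X] (RatFunc ℂ) p / algebraMap ℂ[X] (RatFunc ℂ) q with hf
  have hd : f.denom.eval t ≠ 0 := fun h =>
    hq (eval_eq_zero_of_dvd_of_eval_eq_zero (RatFunc.denom_div_dvd p q) h)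
  have h := congrArg (Polynomial.eval t) ((RatFunc.num_mul_eq_mul_denom_iff hq0).mpr hf)
  simp only [eval_mul] at h
  refine ⟨hd, ?_⟩
  simp only [evalR, RatFunc.eval, eval₂_id]
  rw [div_eq_div_iff hd hq, h]

lemma ratDeriv (hf : DefinedAt f t) : HasEval (ratDeriv f) t (deriv (evalR f) t) := by
  have h := div (p := derivative f.num * f.denom - f.num * derivative f.denom)
    (q := f.denom ^ 2) (t := t) (by rw [eval_pow]; exact pow_ne_zero 2 hf)
  have hderiv : HasDerivAt (evalR f) _ t := (f.num.hasDerivAt t).div (f.denom.hasDerivAt t) hf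
  rw [hderiv.deriv]
  simpa only [_root_.ratDeriv, eval_sub, eval_mul, eval_pow, eval₂_id] using h

end HasEval

lemma eq_of_hasEval {f g : RatFunc ℂ} {q : ℂ[X]} (hq : q ≠ 0)
    (h : ∀ t, q.eval t ≠ 0 → ∃ z, HasEval f t z ∧ HasEval g t z) : f = g := by
  rw [← sub_eq_zero, ← RatFunc.num_eq_zero_iff]
  refine (mul_eq_zero.mp (Polynomial.funext fun t => ?_ : (f - g).num * q = 0)).resolve_right hq
  by_cases ht : q.eval t = 0
  · simp [ht]
  obtain ⟨z, hf, hg⟩ := h t ht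
  obtain ⟨hd, hz⟩ := hf.sub hg
  simp only [evalR, RatFunc.eval, eval₂_id, sub_self] at hz
  simp [(div_eq_zero_iff.mp hz).resolve_right hd]

lemma PoleAtInfty.one_le_intDegree {f : RatFunc ℂ} (hf : PoleAtInfty f) : 1 ≤ f.intDegree := by
  by_contra! hlt
  have hdeg : f.num.degree ≤ f.denom.degree := by
    rw [degree_eq_natDegree f.denom_ne_zero]
    refine degree_le_of_natDegree_le ?_
    rw [RatFunc.intDegree] at hlt
    omega
  obtain ⟨c, hc⟩ := (isBigO_cobounded_of_degree_le hdeg).bound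
  obtain ⟨t, ht, htc⟩ := (hc.and (hf.eventually_gt_atTop (max c 0))).exists
  have hv : evalR f t = f.num.eval t / f.denom.eval t := by
    simp only [evalR, RatFunc.eval, eval₂_id]
  rw [hv, norm_div] at htc
  rcases (norm_nonneg (f.denom.eval t)).eq_or_lt with h0 | h0
  · rw [← h0, div_zero] at htc
    exact absurd htc (not_lt.mpr (le_max_right _ _))
  · exact absurd htc (not_lt.mpr (((div_le_iff₀ h0).mpr ht).trans (le_max_left _ _)))

lemma PoleAtInfty.ne_zero {f : RatFunc ℂ} (hf : PoleAtInfty f) : f ≠ 0 := by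
  rintro rfl
  simpa using hf.one_le_intDegree

lemma PoleAtInfty.degLE_inv {f : RatFunc ℂ} (hf : PoleAtInfty f) : DegLE (-1) f⁻¹ := by
  refine Or.inr ?_
  rw [RatFunc.intDegree_inv]
  have := hf.one_le_intDegree
  omega

/-- The quadratic factor multiplying `f i` in the `i`-th equation of the system. -/
def quadFactor {R : Type*} [CommRing R] (f : Fin 6 → R) (i : Fin 6) : R :=
  f (i + 1) * f (i + 2) + f (i + 1) * f (i + 4) + f (i + 3) * f (i + 4)
    - f (i + 2) * f (i + 3) - f (i + 2) * f (i + 5) - f (i + 4) * f (i + 5)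

/-- Under the constraints, the quadratic factors determine the components. -/
lemma three_mul_sub_eq_quadFactor {R : Type*} [CommRing R] {f : Fin 6 → R} {x : R}
    (h₀ : f 0 + f 2 + f 4 = x) (h₁ : f 1 + f 3 + f 5 = x) (i : Fin 6) :
    x * (3 * f i - x) = quadFactor f (i + 4) - quadFactor f (i + 2)
      - 2 * quadFactor f (i + 1) + 2 * quadFactor f (i + 5) := by
  have h₀' : f 0 = x - f 2 - f 4 := by linear_combination h₀
  have h₁' : f 1 = x - f 3 - f 5 := by linear_combination h₁
  fin_cases i <;> simp [quadFactor, Fin.reduceAdd] <;> rw [h₀', h₁'] <;> ring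

namespace IsA5Solution

variable {α : Fin 6 → ℂ} {f g : Fin 6 → RatFunc ℂ}

lemma add_add_eq_X (hf : IsA5Solution α f) (i : Fin 6) :
    f i + f (i + 2) + f (i + 4) = RatFunc.X := by
  obtain ⟨h₀, h₁, -⟩ := hf
  fin_cases i <;> simp [Fin.reduceAdd]
  · exact h₀
  · exact h₁
  · rw [← h₀]; ring
  · rw [← h₁]; ring
  · rw [← h₀]; ring
  · rw [← h₁]; ring

/-- The differential equations as identities of rational functions. -/
lemma ratDeriv_eq (hf : IsA5Solution α f) (i : Fin 6) :
    RatFunc.C (1 / 2) * RatFunc.X * ratDeriv (f i) =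
      f i * quadFactor f i + RatFunc.C (1 / 2 - α (i + 2) - α (i + 4)) * f i
        + RatFunc.C (α i) * (f (i + 2) + f (i + 4)) := by
  refine eq_of_hasEval (q := ∏ j, (f j).denom)
    (Finset.prod_ne_zero_iff.mpr fun j _ => (f j).denom_ne_zero) fun t ht => ?_
  have hd : ∀ j, DefinedAt (f j) t := by
    rw [eval_prod, Finset.prod_ne_zero_iff] at ht
    exact fun j => ht j (Finset.mem_univ j)
  have he j : HasEval (f j) t (evalR (f j) t) := .of_definedAt (hd j)
  refine ⟨_, ((HasEval.const (1 / 2)).mul .var).mul (.ratDeriv (hd i)), ?_⟩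
  rw [show 1 / 2 * t = t / 2 by ring, hf.2.2 t hd i]
  have hquad := ((((((he (i + 1)).mul (he (i + 2))).add ((he (i + 1)).mul (he (i + 4)))).add
    ((he (i + 3)).mul (he (i + 4)))).sub ((he (i + 2)).mul (he (i + 3)))).sub
    ((he (i + 2)).mul (he (i + 5)))).sub ((he (i + 4)).mul (he (i + 5)))
  exact (((he i).mul hquad).add ((HasEval.const _).mul (he i))).add
    ((HasEval.const _).mul ((he _).add (he _)))

lemma quadFactor_eq (hf : IsA5Solution α f) (i : Fin 6) (hi : f i ≠ 0) :
    quadFactor f i = RatFunc.C (1 / 2) * (RatFunc.X * (ratDeriv (f i) * (f i)⁻¹))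
      - RatFunc.C (1 / 2 - α (i + 2) - α (i + 4))
      - RatFunc.C (α i) * (RatFunc.X * (f i)⁻¹ - RatFunc.C 1) := by
  have h := hf.ratDeriv_eq i
  have hX := hf.add_add_eq_X i
  rw [map_one]
  generalize RatFunc.C (1 / 2 - α (i + 2) - α (i + 4)) = c at h ⊢
  generalize (RatFunc.C (1 / 2) : RatFunc ℂ) = d at h ⊢
  field_simp
  linear_combination -h - RatFunc.C (α i) * hX

lemma degLE_quadFactor (hf : IsA5Solution α f) (hp : ∀ j, PoleAtInfty (f j)) (i : Fin 6) :
    DegLE 0 (quadFactor f i) := by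
  have hi : DegLE (f i).intDegree (f i) := Or.inr le_rfl
  have hinv : DegLE (-(f i).intDegree) (f i)⁻¹ := Or.inr (RatFunc.intDegree_inv _).le
  have hlog : DegLE 0 (RatFunc.X * (ratDeriv (f i) * (f i)⁻¹)) :=
    (DegLE.var.mul (hi.ratDeriv.mul hinv)).mono (by omega)
  rw [hf.quadFactor_eq i (hp i).ne_zero]
  exact ((hlog.const_mul _).sub (.const _)).sub
    (((DegLE.var.mul (hp i).degLE_inv).sub (.const 1)).const_mul _)

lemma degLE_one (hf : IsA5Solution α f) (hp : ∀ j, PoleAtInfty (f j)) (i : Fin 6) :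
    DegLE 1 (f i) := by
  have hq := hf.degLE_quadFactor hp
  have h := three_mul_sub_eq_quadFactor hf.1 hf.2.1 i
  have h3 : DegLE (-1) (3 * f i - RatFunc.X) := by
    refine DegLE.of_X_mul (n := 0) ?_
    rw [h, ← map_ofNat RatFunc.C 2]
    exact (((hq _).sub (hq _)).sub ((hq _).const_mul 2)).add ((hq _).const_mul 2)
  have h1 := ((h3.mono (by norm_num : (-1 : ℤ) ≤ 1)).add .var).const_mul (1 / 3)
  rwa [sub_add_cancel, ← map_ofNat RatFunc.C 3, ← mul_assoc, ← map_mul,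
    one_div_mul_cancel three_ne_zero, map_one, one_mul] at h1

lemma quadFactor_sub_eq (hf : IsA5Solution α f) (hg : IsA5Solution α g) (i : Fin 6)
    (hfi : f i ≠ 0) (hgi : g i ≠ 0) :
    quadFactor f i - quadFactor g i =
      RatFunc.C (1 / 2) * (RatFunc.X * ((ratDeriv (f i - g i) * g i
        - ratDeriv (g i) * (f i - g i)) * ((f i)⁻¹ * (g i)⁻¹)))
      + RatFunc.C (α i) * (RatFunc.X * ((f i - g i) * ((f i)⁻¹ * (g i)⁻¹))) := by
  have hadd : ratDeriv (f i) = ratDeriv (f i - g i) + ratDeriv (g i) := by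
    rw [← ratDeriv_add, sub_add_cancel]
  rw [hf.quadFactor_eq i hfi, hg.quadFactor_eq i hgi, hadd]
  field_simp
  ring

/-- A bound on the degree of the difference of two solutions improves by two. -/
lemma degLE_sub_improve (hf : IsA5Solution α f) (hg : IsA5Solution α g)
    (hpf : ∀ j, PoleAtInfty (f j)) (hpg : ∀ j, PoleAtInfty (g j)) {n : ℤ}
    (h : ∀ j, DegLE n (f j - g j)) (i : Fin 6) : DegLE (n - 2) (f i - g i) := by
  have hq j : DegLE (n - 1) (quadFactor f j - quadFactor g j) := by
    have hinv := (hpf j).degLE_inv.mul (hpg j).degLE_inv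
    have hgj := hg.degLE_one hpg j
    have hnum : DegLE n (ratDeriv (f j - g j) * g j - ratDeriv (g j) * (f j - g j)) :=
      (((h j).ratDeriv.mul hgj).mono (by omega)).sub ((hgj.ratDeriv.mul (h j)).mono (by omega))
    rw [hf.quadFactor_sub_eq hg j (hpf j).ne_zero (hpg j).ne_zero]
    exact (((DegLE.var.mul (hnum.mul hinv)).mono (by omega)).const_mul _).add
      (((DegLE.var.mul ((h j).mul hinv)).mono (by omega)).const_mul _)
  have hX : RatFunc.X * (f i - g i) = RatFunc.C (1 / 3) *
      ((quadFactor f (i + 4) - quadFactor g (i + 4))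
        - (quadFactor f (i + 2) - quadFactor g (i + 2))
        - RatFunc.C 2 * (quadFactor f (i + 1) - quadFactor g (i + 1))
        + RatFunc.C 2 * (quadFactor f (i + 5) - quadFactor g (i + 5))) := by
    have h3 : (RatFunc.C (1 / 3) : RatFunc ℂ) * 3 = 1 := by
      rw [← map_ofNat RatFunc.C 3, ← map_mul, one_div_mul_cancel three_ne_zero, map_one]
    rw [map_ofNat RatFunc.C 2]
    linear_combination RatFunc.C (1 / 3) * three_mul_sub_eq_quadFactor hf.1 hf.2.1 i
      - RatFunc.C (1 / 3) * three_mul_sub_eq_quadFactor hg.1 hg.2.1 i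
      - RatFunc.X * (f i - g i) * h3
  have hd : DegLE (n - 1) (RatFunc.X * (f i - g i)) := by
    rw [hX]
    exact ((((hq _).sub (hq _)).sub ((hq _).const_mul 2)).add ((hq _).const_mul 2)).const_mul _
  exact hd.of_X_mul.mono (by omega)

end IsA5Solution

/-- Uniqueness of a Type C rational solution. -/
theorem stmt_13 (α : Fin 6 → ℂ)
    (hsum : α 0 + α 1 + α 2 + α 3 + α 4 + α 5 = 1)
    (f g : Fin 6 → RatFunc ℂ)
    (hf : IsA5Solution α f) (hg : IsA5Solution α g)
    (hfpoles : ∀ j : Fin 6, PoleAtInfty (f j))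
    (hgpoles : ∀ j : Fin 6, PoleAtInfty (g j)) :
    ∀ j : Fin 6, f j = g j := by
  have hdeg (k : ℕ) : ∀ j, DegLE (1 - 2 * k) (f j - g j) := by
    induction k with
    | zero => exact fun j => by simpa using (hf.degLE_one hfpoles j).sub (hg.degLE_one hgpoles j)
    | succ k ih =>
      exact fun j => (hf.degLE_sub_improve hg hfpoles hgpoles ih j).mono (by push_cast; omega)
  intro j
  by_contra hne
  have h := (hdeg (1 + (f j - g j).intDegree.natAbs) j).resolve_left (sub_ne_zero.mpr hne)
  rw [Nat.cast_add, Nat.cast_one] at h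
  omega
end
end

section
/- For each i ∈ {0,…,5} (indices mod 6), the following explicit tuples are rational solutions of the A_5^(1) Painlevé system with the indicated parameters: (a) f_i = f_{i+1} = t and f_{i+2} = f_{i+3} = f_{i+4} = f_{i+5} = 0 solves A_5(α) whenever α_i + α_{i+1} = 1 and α_{i+2} = α_{i+3} = α_{i+4} = α_{i+5} = 0; (b) f_i = f_{i+3} = t and f_{i+1} = f_{i+2} = f_{i+4} = f_{i+5} = 0 solves A_5(α) whenever α_i + α_{i+3} = 1 and α_{i+1} = α_{i+2} = α_{i+4} = α_{i+5} = 0; (c) f_i = f_{i+1} = f_{i+2} = t, f_{i+3} = 0, f_{i+4} = −t, f_{i+5} = 0 solves A_5(α) whenever α_i = α_{i+2}, α_i + α_{i+4} = 0, α_{i+3} = α_{i+5} = 0, and the α's sum to 1; (d) f_i = f_{i+1} = f_{i+2} = f_{i+3} = t/2 and f_{i+4} = f_{i+5} = 0 solves A_5(α) whenever α_i = α_{i+2}, α_{i+1} = α_{i+3}, α_{i+4} = α_{i+5} = 0, and the α's sum to 1; (e) f_0 = f_1 = f_2 = f_3 = f_4 = f_5 = t/3 solves A_5(α) whenever α_0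 = α_2 = α_4, α_1 = α_3 = α_5, and the α's sum to 1. -/
open Filter Topology Polynomial

noncomputable section

/-- Dividing `X` by a numeral is multiplying it by a constant. -/
lemma X_div_ofNat (n : ℕ) [n.AtLeastTwo] :
    (RatFunc.X : RatFunc ℂ) / OfNat.ofNat n = RatFunc.C (1 / OfNat.ofNat n) * RatFunc.X := by
  have h : RatFunc.C (OfNat.ofNat n : ℂ) = OfNat.ofNat n := map_ofNat RatFunc.C n
  rw [map_div₀, map_one, h, one_div, div_eq_inv_mul]

/-- The evaluation of the rational function `c X` is `t ↦ c t`. -/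
lemma evalR_C_mul_X (c t : ℂ) : evalR (RatFunc.C c * RatFunc.X) t = c * t := by
  have h : RatFunc.C c * RatFunc.X =
      algebraMap ℂ[X] (RatFunc ℂ) (Polynomial.C c * Polynomial.X) := by
    simp
  rw [h, evalR, RatFunc.eval_algebraMap]
  simp

/-- A tuple `f_j = c_j t` solves `A₅(α)` as soon as the cubic and the linear parts of the
system hold separately for the coefficients `c_j`. -/
lemma isA5Solution_of_linear {α c : Fin 6 → ℂ} {f : Fin 6 → RatFunc ℂ}
    (hf : ∀ j, f j = RatFunc.C (c j) * RatFunc.X)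
    (heven : c 0 + c 2 + c 4 = 1) (hodd : c 1 + c 3 + c 5 = 1)
    (hcubic : ∀ i, c i * (c (i + 1) * c (i + 2) + c (i + 1) * c (i + 4) + c (i + 3) * c (i + 4)
      - c (i + 2) * c (i + 3) - c (i + 2) * c (i + 5) - c (i + 4) * c (i + 5)) = 0)
    (hlin : ∀ i, α i * (c (i + 2) + c (i + 4)) = (α (i + 2) + α (i + 4)) * c i) :
    IsA5Solution α f := by
  refine ⟨?_, ?_, fun t _ i => ?_⟩
  · simp only [hf, ← add_mul, ← map_add, heven, map_one, one_mul]
  · simp only [hf, ← add_mul, ← map_add, hodd, map_one, one_mul]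
  · have hderiv : deriv (evalR (f i)) t = c i := by
      have h : evalR (f i) = fun s => c i * s := by
        funext s
        rw [hf, evalR_C_mul_X]
      rw [h]
      simp
    rw [hderiv]
    simp only [hf, evalR_C_mul_X]
    linear_combination (-t ^ 3) * hcubic i - t * hlin i

set_option maxHeartbeats 1000000 in
/-- Explicit rational solutions of the `A₅⁽¹⁾` system for the indicated parameters. -/
theorem stmt_14 :
    (∀ (α : Fin 6 → ℂ) (i : Fin 6),
        α i + α (i + 1) = 1 → α (i + 2) = 0 → α (i + 3) = 0 → α (i + 4) = 0 →
        α (i + 5) = 0 →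
        IsA5Solution α (fun j => if j = i ∨ j = i + 1 then RatFunc.X else 0)) ∧
    (∀ (α : Fin 6 → ℂ) (i : Fin 6),
        α i + α (i + 3) = 1 → α (i + 1) = 0 → α (i + 2) = 0 → α (i + 4) = 0 →
        α (i + 5) = 0 →
        IsA5Solution α (fun j => if j = i ∨ j = i + 3 then RatFunc.X else 0)) ∧
    (∀ (α : Fin 6 → ℂ) (i : Fin 6),
        α i = α (i + 2) → α i + α (i + 4) = 0 → α (i + 3) = 0 → α (i + 5) = 0 →
        α 0 + α 1 + α 2 + α 3 + α 4 + α 5 = 1 →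
        IsA5Solution α (fun j =>
          if j = i ∨ j = i + 1 ∨ j = i + 2 then RatFunc.X
          else if j = i + 4 then -RatFunc.X else 0)) ∧
    (∀ (α : Fin 6 → ℂ) (i : Fin 6),
        α i = α (i + 2) → α (i + 1) = α (i + 3) → α (i + 4) = 0 → α (i + 5) = 0 →
        α 0 + α 1 + α 2 + α 3 + α 4 + α 5 = 1 →
        IsA5Solution α (fun j =>
          if j = i ∨ j = i + 1 ∨ j = i + 2 ∨ j = i + 3 then RatFunc.X / 2 else 0)) ∧
    (∀ α : Fin 6 → ℂ,
        α 0 = α 2 → α 2 = α 4 → α 1 = α 3 → α 3 = α 5 →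
        α 0 + α 1 + α 2 + α 3 + α 4 + α 5 = 1 →
        IsA5Solution α (fun _ => RatFunc.X / 3)) := by
  refine ⟨?_, ?_, ?_, ?_, ?_⟩
  · intro α i h0 h2 h3 h4 h5
    refine isA5Solution_of_linear
      (c := fun j => if j = i ∨ j = i + 1 then 1 else 0)
      ?_ ?_ ?_ ?_ ?_
    · intro j
      split_ifs <;> simp
    · fin_cases i <;> simp [Fin.ext_iff]
    · fin_cases i <;> simp [Fin.ext_iff]
    · intro k
      fin_cases i <;> fin_cases k <;> simp [Fin.ext_iff]
    · intro k
      fin_cases i <;> fin_cases k <;> simp [Fin.ext_iff] at * <;> grind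
  · intro α i h0 h1 h2 h4 h5
    refine isA5Solution_of_linear
      (c := fun j => if j = i ∨ j = i + 3 then 1 else 0)
      ?_ ?_ ?_ ?_ ?_
    · intro j
      split_ifs <;> simp
    · fin_cases i <;> simp [Fin.ext_iff]
    · fin_cases i <;> simp [Fin.ext_iff]
    · intro k
      fin_cases i <;> fin_cases k <;> simp [Fin.ext_iff]
    · intro k
      fin_cases i <;> fin_cases k <;> simp [Fin.ext_iff] at * <;> grind
  · intro α i h0 h2 h3 h5 hsum
    refine isA5Solution_of_linear
      (c := fun j => if j = i ∨ j = i + 1 ∨ j = i + 2 then 1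
        else if j = i + 4 then -1 else 0)
      ?_ ?_ ?_ ?_ ?_
    · intro j
      split_ifs <;> simp
    · fin_cases i <;> simp [Fin.ext_iff]
    · fin_cases i <;> simp [Fin.ext_iff]
    · intro k
      fin_cases i <;> fin_cases k <;> simp [Fin.ext_iff]
    · intro k
      fin_cases i <;> fin_cases k <;> simp [Fin.ext_iff] at * <;> grind
  · intro α i h0 h1 h4 h5 hsum
    refine isA5Solution_of_linear
      (c := fun j => if j = i ∨ j = i + 1 ∨ j = i + 2 ∨ j = i + 3 then 1 / 2 else 0)
      ?_ ?_ ?_ ?_ ?_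
    · intro j
      split_ifs
      · exact X_div_ofNat 2
      · simp
    · fin_cases i <;> simp [Fin.ext_iff] <;> norm_num
    · fin_cases i <;> simp [Fin.ext_iff] <;> norm_num
    · intro k
      fin_cases i <;> fin_cases k <;> simp [Fin.ext_iff]
    · intro k
      fin_cases i <;> fin_cases k <;> simp [Fin.ext_iff] at * <;> grind
  · intro α h0 h2 h1 h3 hsum
    refine isA5Solution_of_linear (c := fun _ => 1 / 3) ?_ ?_ ?_ ?_ ?_
    · intro j
      exact X_div_ofNat 3
    · norm_num
    · norm_num
    · intro k
      ring
    · intro k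
      fin_cases k <;> simp <;> grind
end
end

section
/- Let (f_0,…,f_5) be a rational solution of A_5(α_0,…,α_5). If c ∈ ℂ with c ≠ 0 is a pole of f_j for some j ∈ {0,…,5}, then this pole is simple and its residue is a half-integer; more precisely, the limit of (t − c)·f_j(t) as t → c exists and lies in the set {−3/2, −1/2, 1/2, 3/2}. -/
open Filter Topology Polynomial

noncomputable section

local notation "𝐗" => (PowerSeries.X : PowerSeries ℂ)
local notation "ev" => (PowerSeries.constantCoeff : PowerSeries ℂ →+* ℂ)
local notation "∂" => (PowerSeries.derivative ℂ)

/-- The local coordinate `t = s + c` as a power series in `s`. -/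
def coord (c : ℂ) : PowerSeries ℂ := 𝐗 + PowerSeries.C c

/-- The coefficient of `F₀` on the right of the equation for `F₀`, once `F₃` is eliminated and
denominators are cleared. -/
def logTerm (c : ℂ) (n : ℕ) (F₁ F₂ F₄ F₅ : PowerSeries ℂ) : PowerSeries ℂ :=
  4 * (F₁ * F₂ - F₅ * F₄) + 2 * 𝐗 ^ n * coord c * (F₄ - F₂)

/-- The equation of the component `F₀ / s ^ m` in the local coordinate `s = t - c`, where the
components of the same parity have denominator `s ^ m` and the others `s ^ n`. -/
def LocalOde (c : ℂ) (m n : ℕ) (F₀ F₁ F₂ F₄ F₅ : PowerSeries ℂ) : Prop :=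
  ∃ α κ : ℂ, coord c * (𝐗 * ∂ F₀ - (m : PowerSeries ℂ) * F₀) * 𝐗 ^ (m + n) =
    𝐗 * (F₀ * logTerm c n F₁ F₂ F₄ F₅ + PowerSeries.C κ * F₀ * 𝐗 ^ (m + n)
      + PowerSeries.C α * coord c * 𝐗 ^ (2 * m + n))

/-- The whole system at `c`, for even components `F₀, F₂, F₄` over `s ^ m` and odd components
`F₁, F₃, F₅` over `s ^ n`. -/
structure LocalSystem (c : ℂ) (m n : ℕ) (F₀ F₁ F₂ F₃ F₄ F₅ : PowerSeries ℂ) : Prop where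
  sum_even : F₀ + F₂ + F₄ = 𝐗 ^ m * coord c
  sum_odd : F₁ + F₃ + F₅ = 𝐗 ^ n * coord c
  ode₀ : LocalOde c m n F₀ F₁ F₂ F₄ F₅
  ode₁ : LocalOde c n m F₁ F₂ F₃ F₅ F₀
  ode₂ : LocalOde c m n F₂ F₃ F₄ F₀ F₁
  ode₃ : LocalOde c n m F₃ F₄ F₅ F₁ F₂
  ode₄ : LocalOde c m n F₄ F₅ F₀ F₂ F₃
  ode₅ : LocalOde c n m F₅ F₀ F₁ F₃ F₄

theorem ev_coord (c : ℂ) : ev (coord c) = c := by simp [coord]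

variable {c : ℂ} {m n : ℕ} {F₀ F₁ F₂ F₃ F₄ F₅ : PowerSeries ℂ}

theorem LocalSystem.rotate (h : LocalSystem c m n F₀ F₁ F₂ F₃ F₄ F₅) :
    LocalSystem c n m F₁ F₂ F₃ F₄ F₅ F₀ :=
  ⟨h.sum_odd, by rw [← h.sum_even]; ring, h.ode₁, h.ode₂, h.ode₃, h.ode₄, h.ode₅, h.ode₀⟩

theorem LocalOde.exists_logTerm_eq (h : LocalOde c m n F₀ F₁ F₂ F₄ F₅) (h0 : ev F₀ ≠ 0) {k : ℕ}
    (hk : m + n = k + 1) :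
    ∃ q, logTerm c n F₁ F₂ F₄ F₅ = 𝐗 ^ k * q ∧ ev q = -c * m := by
  obtain ⟨α, κ, h⟩ := h
  have hinv := PowerSeries.mul_inv_cancel F₀ h0
  have key : F₀ * logTerm c n F₁ F₂ F₄ F₅ = 𝐗 ^ k * (coord c * (𝐗 * ∂ F₀ - (m : PowerSeries ℂ) * F₀)
      - PowerSeries.C κ * F₀ * 𝐗 - PowerSeries.C α * coord c * 𝐗 ^ (m + 1)) := by
    apply mul_left_cancel₀ (PowerSeries.X_ne_zero (R := ℂ))
    rw [show 2 * m + n = m + (k + 1) by omega, hk] at h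
    linear_combination -h
  refine ⟨F₀⁻¹ * (coord c * (𝐗 * ∂ F₀ - (m : PowerSeries ℂ) * F₀)
      - PowerSeries.C κ * F₀ * 𝐗 - PowerSeries.C α * coord c * 𝐗 ^ (m + 1)), ?_, ?_⟩
  · calc logTerm c n F₁ F₂ F₄ F₅ = F₀⁻¹ * (F₀ * logTerm c n F₁ F₂ F₄ F₅) := by
          linear_combination (-logTerm c n F₁ F₂ F₄ F₅) * hinv
      _ = _ := by rw [key, mul_left_comm]
  · simp [ev_coord]
    field_simp

theorem LocalOde.leading (h : LocalOde c m n F₀ F₁ F₂ F₄ F₅) {k : ℕ} (hk : m + n = k + 1) :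
    c * (-m * ev F₀) * 0 ^ k = ev F₀ * (4 * (ev F₁ * ev F₂ - ev F₅ * ev F₄)
      + 2 * 0 ^ n * c * (ev F₄ - ev F₂)) := by
  obtain ⟨α, κ, h⟩ := h
  have key : coord c * (𝐗 * ∂ F₀ - (m : PowerSeries ℂ) * F₀) * 𝐗 ^ k =
      F₀ * logTerm c n F₁ F₂ F₄ F₅ + PowerSeries.C κ * F₀ * 𝐗 ^ (k + 1)
      + PowerSeries.C α * coord c * 𝐗 ^ (m + k + 1) := by
    apply mul_left_cancel₀ (PowerSeries.X_ne_zero (R := ℂ))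
    rw [show 2 * m + n = m + k + 1 by omega, hk] at h
    linear_combination h
  simpa [ev_coord, logTerm, map_ofNat] using congrArg ev key

/-- The admissible residues, with `0` standing for a component that has no pole. -/
def IsHalf (r : ℂ) : Prop := r = 0 ∨ r = -(3 / 2) ∨ r = -(1 / 2) ∨ r = 1 / 2 ∨ r = 3 / 2

/-- Three components over `s ^ m` have at most simple poles, with admissible residues. -/
def SimplePoles (m : ℕ) (F₀ F₂ F₄ : PowerSeries ℂ) : Prop :=
  m = 0 ∨ m = 1 ∧ IsHalf (ev F₀) ∧ IsHalf (ev F₂) ∧ IsHalf (ev F₄)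

theorem LocalSystem.ev_sum_even (h : LocalSystem c (m + 1) n F₀ F₁ F₂ F₃ F₄ F₅) :
    ev F₀ + ev F₂ + ev F₄ = 0 := by
  simpa using congrArg ev h.sum_even

theorem isHalf_of_residue_equations_of_eq_zero {a₀ a₂ a₄ b₃ b₅ ε : ℂ} (hc : c ≠ 0)
    (hε : ε = 0 ∨ ε = 1) (ha : a₀ + a₂ + a₄ = 0) (hb : b₃ + b₅ = c)
    (hne : a₀ ≠ 0 ∨ a₂ ≠ 0 ∨ a₄ ≠ 0) (h₅ : b₅ * (a₄ * b₃) = 0)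
    (h₀ : a₀ * (4 * (-b₅ * a₄) + 2 * c * (a₄ - a₂) + c * ε) = 0)
    (h₂ : a₂ * (4 * (b₃ * a₄) + 2 * c * (a₀ - a₄) + c * ε) = 0)
    (h₄ : a₄ * (4 * (b₅ * a₀ - b₃ * a₂) + 2 * c * (a₂ - a₀) + c * ε) = 0) :
    ε = 1 ∧ IsHalf a₀ ∧ IsHalf a₂ ∧ IsHalf a₄ := by
  unfold IsHalf
  simp only [mul_eq_zero] at *
  grind

theorem isHalf_of_residue_equations {a₀ a₂ a₄ b₁ b₃ b₅ ε : ℂ} (hc : c ≠ 0) (hε : ε = 0 ∨ ε = 1)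
    (ha : a₀ + a₂ + a₄ = 0) (hb : b₁ + b₃ + b₅ = c) (hne : a₀ ≠ 0 ∨ a₂ ≠ 0 ∨ a₄ ≠ 0)
    (h₁ : b₁ * (a₂ * b₃ - a₀ * b₅) = 0) (h₃ : b₃ * (a₄ * b₅ - a₂ * b₁) = 0)
    (h₅ : b₅ * (a₀ * b₁ - a₄ * b₃) = 0)
    (h₀ : a₀ * (4 * (b₁ * a₂ - b₅ * a₄) + 2 * c * (a₄ - a₂) + c * ε) = 0)
    (h₂ : a₂ * (4 * (b₃ * a₄ - b₁ * a₀) + 2 * c * (a₀ - a₄) + c * ε) = 0)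
    (h₄ : a₄ * (4 * (b₅ * a₀ - b₃ * a₂) + 2 * c * (a₂ - a₀) + c * ε) = 0) :
    ε = 1 ∧ IsHalf a₀ ∧ IsHalf a₂ ∧ IsHalf a₄ := by
  have hzero : b₁ = 0 ∨ b₃ = 0 ∨ b₅ = 0 := by
    by_contra! hcon
    obtain ⟨n₁, n₃, n₅⟩ := hcon
    have k₁ := (mul_eq_zero.mp h₁).resolve_left n₁
    have k₃ := (mul_eq_zero.mp h₃).resolve_left n₃
    have k₅ := (mul_eq_zero.mp h₅).resolve_left n₅
    have z₀ : a₀ * c = 0 := by linear_combination b₃ * ha - a₀ * hb - k₁ + k₅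
    have z₂ : a₂ * c = 0 := by linear_combination b₅ * ha - a₂ * hb + k₁ - k₃
    have z₄ : a₄ * c = 0 := by linear_combination b₁ * ha - a₄ * hb + k₃ - k₅
    simp_all
  rcases hzero with rfl | rfl | rfl
  · exact isHalf_of_residue_equations_of_eq_zero (b₃ := b₃) (b₅ := b₅) hc hε ha
      (by linear_combination hb) hne (by linear_combination -h₅) (by linear_combination h₀)
      (by linear_combination h₂) h₄
  · obtain ⟨h, i₂, i₄, i₀⟩ := isHalf_of_residue_equations_of_eq_zero (a₀ := a₂) (a₂ := a₄)
      (a₄ := a₀) (b₃ := b₅) (b₅ := b₁) hc hε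
      (by linear_combination ha) (by linear_combination hb) (by tauto)
      (by linear_combination -h₁) (by linear_combination h₂) (by linear_combination h₄) h₀
    exact ⟨h, i₀, i₂, i₄⟩
  · obtain ⟨h, i₄, i₀, i₂⟩ := isHalf_of_residue_equations_of_eq_zero (a₀ := a₄) (a₂ := a₀)
      (a₄ := a₂) (b₃ := b₁) (b₅ := b₃) hc hε
      (by linear_combination ha) (by linear_combination hb) (by tauto)
      (by linear_combination -h₃) (by linear_combination h₄) (by linear_combination h₀) h₂
    exact ⟨h, i₀, i₂, i₄⟩

theorem LocalSystem.simplePoles_of_odd_regular (hc : c ≠ 0)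
    (h : LocalSystem c (m + 1) 0 F₀ F₁ F₂ F₃ F₄ F₅)
    (hne : ev F₀ ≠ 0 ∨ ev F₂ ≠ 0 ∨ ev F₄ ≠ 0) : 
    m = 0 ∧ IsHalf (ev F₀) ∧ IsHalf (ev F₂) ∧ IsHalf (ev F₄) := by
  have sa := h.ev_sum_even
  have sb : ev F₁ + ev F₃ + ev F₅ = c := by simpa [ev_coord] using congrArg ev h.sum_odd
  have e0 := h.ode₀.leading (k := m) rfl
  have e2 := h.ode₂.leading (k := m) rfl
  have e4 := h.ode₄.leading (k := m) rfl
  have e1 := h.ode₁.leading (k := m) (by omega)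
  have e3 := h.ode₃.leading (k := m) (by omega)
  have e5 := h.ode₅.leading (k := m) (by omega)
  simp only [pow_succ, mul_zero, zero_mul, pow_zero, Nat.cast_zero, neg_zero, add_zero,
    mul_one] at e0 e1 e2 e3 e4 e5
  have hε : ((m + 1 : ℕ) : ℂ) * 0 ^ m = 0 ∨ ((m + 1 : ℕ) : ℂ) * 0 ^ m = 1 := by
    rcases m with _ | m <;> simp
  obtain ⟨h1, hI⟩ := isHalf_of_residue_equations hc hε sa sb hne (by linear_combination -e1 / 4)
    (by linear_combination -e3 / 4) (by linear_combination -e5 / 4) (by linear_combination -e0)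
    (by linear_combination -e2) (by linear_combination -e4)
  refine ⟨?_, hI⟩
  rcases m with _ | m
  · rfl
  · simp at h1

theorem LocalSystem.ev_eq_of_all_leading_ne_zero (hc : c ≠ 0)
    (h : LocalSystem c (m + 1) (n + 1) F₀ F₁ F₂ F₃ F₄ F₅)
    (h0 : ev F₀ ≠ 0) (h2 : ev F₂ ≠ 0) (h4 : ev F₄ ≠ 0) (h1 : ev F₁ ≠ 0) :
    ev F₄ = - 2 * ev F₁ := by
  obtain ⟨q0, hq0, hq0'⟩ := h.ode₀.exists_logTerm_eq (k := m + n + 1) h0 (by omega)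
  obtain ⟨q2, hq2, hq2'⟩ := h.ode₂.exists_logTerm_eq (k := m + n + 1) h2 (by omega)
  obtain ⟨r, hr⟩ : 𝐗 ∣ q2 - q0 := by
    rw [PowerSeries.X_dvd_iff]; simp [hq0', hq2']
  have key : - 2 * 𝐗 ^ (n + 1) * coord c * F₄ =
      2 * 𝐗 ^ (m + 1) * coord c * (2 * F₁ - 𝐗 ^ (n + 1) * coord c)
      + 𝐗 ^ (m + n + 2) * r := by
    rw [logTerm] at hq0 hq2
    have h1 := h.sum_even
    have h2 := h.sum_odd
    linear_combination hq2 - hq0 - 2 * coord c * 𝐗 ^ (n + 1) * h1 - 4 * F₄ * h2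
      + 4 * F₁ * h1 + 𝐗 ^ (m + n + 1) * hr
  rcases lt_trichotomy m n with hmn | rfl | hmn
  · exfalso
    obtain ⟨d, rfl⟩ := Nat.exists_eq_add_of_lt hmn
    have : -2 * 𝐗 ^ (d + 1) * coord c * F₄ =
        2 * coord c * (2 * F₁ - 𝐗 ^ (m + d + 1 + 1) * coord c) + 𝐗 ^ (m + d + 2) * r := by
      apply mul_left_cancel₀ (pow_ne_zero (m + 1) (PowerSeries.X_ne_zero (R := ℂ)))
      linear_combination key
    simpa [ev_coord, map_ofNat, hc, h1] using congrArg ev this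
  · have : -2 * coord c * F₄ =
        2 * coord c * (2 * F₁ - 𝐗 ^ (m + 1) * coord c) + 𝐗 ^ (m + 1) * r := by
      apply mul_left_cancel₀ (pow_ne_zero (m + 1) (PowerSeries.X_ne_zero (R := ℂ)))
      linear_combination key
    have := congrArg ev this
    simp only [ev_coord, map_ofNat, map_mul, map_add, map_sub, map_neg, map_pow,
      PowerSeries.constantCoeff_X, pow_succ, mul_zero, zero_mul] at this
    apply mul_left_cancel₀ hc
    linear_combination -this / 2
  · exfalso
    obtain ⟨d, rfl⟩ := Nat.exists_eq_add_of_lt hmn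
    have : -2 * coord c * F₄ = 2 * 𝐗 ^ (d + 1) * coord c * (2 * F₁ - 𝐗 ^ (n + 1) * coord c)
        + 𝐗 ^ (n + d + 2) * r := by
      apply mul_left_cancel₀ (pow_ne_zero (n + 1) (PowerSeries.X_ne_zero (R := ℂ)))
      linear_combination key
    simpa [ev_coord, map_ofNat, hc, h4] using congrArg ev this

theorem LocalSystem.odd_order_le (hc : c ≠ 0)
    (h : LocalSystem c (m + 1) (n + 1) F₀ F₁ F₂ F₃ F₄ F₅)
    (h0 : ev F₀ ≠ 0) (h3 : ev F₃ ≠ 0) (h5 : ev F₅ ≠ 0) (h1 : ev F₁ = 0) : n ≤ m := by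
  by_contra! hmn
  obtain ⟨d, rfl⟩ := Nat.exists_eq_add_of_lt hmn
  obtain ⟨q0, hq0, -⟩ := h.ode₀.exists_logTerm_eq (k := m + (m + d + 1) + 1) h0 (by omega)
  obtain ⟨q3, hq3, -⟩ := h.ode₃.exists_logTerm_eq (k := m + (m + d + 1) + 1) h3 (by omega)
  have : 2 * coord c * (𝐗 ^ (d + 1) * (F₄ - F₂) + (F₁ - F₅)) = 𝐗 ^ (m + d + 1) * (q0 + q3) := by
    apply mul_left_cancel₀ (pow_ne_zero (m + 1) (PowerSeries.X_ne_zero (R := ℂ)))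
    rw [logTerm] at hq0 hq3
    linear_combination hq0 + hq3
  simpa [ev_coord, map_ofNat, hc, h1, h5] using congrArg ev this

theorem exists_eq_X_pow_mul_of_coord_mul {A q : PowerSeries ℂ} (hc : c ≠ 0)
    (h : 2 * coord c * A = 𝐗 ^ m * q) :
    ∃ w, A = 𝐗 ^ m * w ∧ 2 * c * ev w = ev q := by
  have hinv := PowerSeries.mul_inv_cancel (coord c) (by simpa [ev_coord] using hc)
  have h2 : PowerSeries.C (1 / 2 : ℂ) * 2 = 1 := by
    rw [← map_ofNat PowerSeries.C 2, ← map_mul]; norm_num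
  refine ⟨PowerSeries.C (1 / 2) * (coord c)⁻¹ * q, ?_, ?_⟩
  · linear_combination (PowerSeries.C (1 / 2) * (coord c)⁻¹) * h - A * h2
      - (PowerSeries.C (1 / 2) * 2) * A * hinv
  · simp [ev_coord]
    field_simp

theorem LocalSystem.exists_pair_sums (hc : c ≠ 0)
    (h : LocalSystem c (m + 1) (m + 1) F₀ F₁ F₂ F₃ F₄ F₅)
    (h0 : ev F₀ ≠ 0) (h2 : ev F₂ ≠ 0) (h3 : ev F₃ ≠ 0) (h5 : ev F₅ ≠ 0) :
    ∃ x y Z, F₀ + F₃ = 𝐗 ^ m * x ∧ F₂ + F₅ = 𝐗 ^ m * y ∧ F₁ + F₄ = 𝐗 ^ (m + 1) * Z ∧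
      ev x = -(m + 1) ∧ ev y = m + 1 ∧ x + y + 𝐗 * Z = 2 * 𝐗 * coord c := by
  obtain ⟨q0, hq0, e0⟩ := h.ode₀.exists_logTerm_eq (k := m + m + 1) h0 (by omega)
  obtain ⟨q2, hq2, e2⟩ := h.ode₂.exists_logTerm_eq (k := m + m + 1) h2 (by omega)
  obtain ⟨q3, hq3, e3⟩ := h.ode₃.exists_logTerm_eq (k := m + m + 1) h3 (by omega)
  obtain ⟨q5, hq5, e5⟩ := h.ode₅.exists_logTerm_eq (k := m + m + 1) h5 (by omega)
  rw [logTerm] at hq0 hq2 hq3 hq5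
  obtain ⟨w, hw, ew⟩ := exists_eq_X_pow_mul_of_coord_mul (c := c) (m := m)
    (A := F₁ + F₄ - F₂ - F₅) (q := q0 + q3) hc (by
      apply mul_left_cancel₀ (pow_ne_zero (m + 1) (PowerSeries.X_ne_zero (R := ℂ)))
      linear_combination hq0 + hq3)
  obtain ⟨v, hv, e_v⟩ := exists_eq_X_pow_mul_of_coord_mul (c := c) (m := m)
    (A := F₀ + F₃ - F₁ - F₄) (q := q2 + q5) hc (by
      apply mul_left_cancel₀ (pow_ne_zero (m + 1) (PowerSeries.X_ne_zero (R := ℂ)))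
      linear_combination hq2 + hq5)
  have ew' : ev w = -(m + 1) := by
    apply mul_left_cancel₀ (mul_ne_zero two_ne_zero hc)
    rw [ew, map_add, e0, e3]; push_cast; ring
  have ev' : ev v = -(m + 1) := by
    apply mul_left_cancel₀ (mul_ne_zero two_ne_zero hc)
    rw [e_v, map_add, e2, e5]; push_cast; ring
  obtain ⟨u, hu⟩ : 𝐗 ∣ w - v := by
    rw [PowerSeries.X_dvd_iff]; simp [ew', ev']
  have third : PowerSeries.C (1 / 3 : ℂ) * 3 = 1 := by
    rw [← map_ofNat PowerSeries.C 3, ← map_mul]; norm_num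
  have hZ : F₁ + F₄ = 𝐗 ^ (m + 1) * (PowerSeries.C (1 / 3) * (2 * coord c + u)) := by
    linear_combination PowerSeries.C (1 / 3) * (h.sum_even + h.sum_odd + hw - hv + 𝐗 ^ m * hu)
      - (F₁ + F₄) * third
  refine ⟨v + 𝐗 * (PowerSeries.C (1 / 3) * (2 * coord c + u)),
    𝐗 * (PowerSeries.C (1 / 3) * (2 * coord c + u)) - w, _, ?_, ?_, hZ, ?_, ?_, ?_⟩
  · linear_combination hv + hZ
  · linear_combination hZ - hw
  · simp [ev']
  · simp [ew']
  · linear_combination -hu + (2 * 𝐗 * coord c + 𝐗 * u) * third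

theorem LocalSystem.ev_relation
    (h : LocalSystem c (m + 1) (m + 1) F₀ F₁ F₂ F₃ F₄ F₅) {y Z H : PowerSeries ℂ}
    (h0 : ev F₀ ≠ 0) (hy : F₂ + F₅ = 𝐗 ^ m * y) (hZ : F₁ + F₄ = 𝐗 ^ (m + 1) * Z)
    (ey : ev y = m + 1) (hH : F₄ = 𝐗 * H) :
    4 * ev Z * ev F₂ - 4 * (m + 1) * ev H - 2 * c * ev F₂ = -c * (m + 1) * 0 ^ m := by
  obtain ⟨q, hq, eq⟩ := h.ode₀.exists_logTerm_eq (k := m + m + 1) h0 (by omega)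
  have key : 4 * Z * F₂ - 4 * y * H + 2 * coord c * (𝐗 * H - F₂) = 𝐗 ^ m * q := by
    apply mul_left_cancel₀ (pow_ne_zero (m + 1) (PowerSeries.X_ne_zero (R := ℂ)))
    rw [logTerm] at hq
    linear_combination hq - 4 * F₂ * hZ + 4 * F₄ * hy
      + (4 * 𝐗 ^ m * y - 2 * 𝐗 ^ (m + 1) * coord c) * hH
  have := congrArg ev key
  simp only [ev_coord, map_ofNat, map_mul, map_add, map_sub, map_pow,
    PowerSeries.constantCoeff_X, zero_mul, zero_sub, eq, ey] at this
  push_cast at this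
  linear_combination this

theorem exists_eq_X_pow_mul_of_not_dvd {H : PowerSeries ℂ} {k : ℕ} (h : ¬ 𝐗 ^ (k + 1) ∣ H) :
    ∃ l U, l ≤ k ∧ H = 𝐗 ^ l * U ∧ ev U ≠ 0 := by
  have hfin : FiniteMultiplicity 𝐗 H := ⟨k, h⟩
  obtain ⟨U, hU, hd⟩ := hfin.exists_eq_pow_mul_and_not_dvd
  refine ⟨_, U, ?_, hU, fun h0 => hd (PowerSeries.X_dvd_iff.mpr h0)⟩
  exact Nat.lt_succ_iff.mp (hfin.multiplicity_lt_iff_not_dvd.mpr h)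

theorem LocalOde.ev_logTerm_quotient_eq_zero {H B : PowerSeries ℂ}
    (h : LocalOde c (m + 1) (m + 1) (𝐗 * H) F₁ F₂ F₄ F₅)
    (hB : logTerm c (m + 1) F₁ F₂ F₄ F₅ = 𝐗 ^ (m + 1) * B) (hH : ¬ 𝐗 ^ (m + 1) ∣ H) :
    ev B = 0 := by
  obtain ⟨l, U, hl, rfl, hU⟩ := exists_eq_X_pow_mul_of_not_dvd hH
  obtain ⟨j, rfl⟩ := Nat.exists_eq_add_of_le hl
  obtain ⟨α, κ, h⟩ := h
  have hd : 𝐗 * ∂ (𝐗 ^ l * U) = 𝐗 ^ l * ((l : PowerSeries ℂ) * U + 𝐗 * ∂ U) := by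
    rcases l with _ | l
    · simp
    · simp [Derivation.leibniz]; ring
  have hd' : ∂ (𝐗 * (𝐗 ^ l * U)) = 𝐗 ^ l * U + 𝐗 * ∂ (𝐗 ^ l * U) := by
    simp only [Derivation.leibniz, PowerSeries.derivative_X, smul_eq_mul]; ring
  have key : 𝐗 ^ (l + j) * (coord c * (𝐗 * ∂ U - (j : PowerSeries ℂ) * U)) =
      U * B + PowerSeries.C κ * U * 𝐗 ^ (l + j + 1)
        + PowerSeries.C α * coord c * 𝐗 ^ (l + 2 * j + 1) := by
    apply mul_left_cancel₀ (pow_ne_zero (2 * l + j + 3) (PowerSeries.X_ne_zero (R := ℂ)))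
    rw [hd', hB, hd] at h
    push_cast at h
    linear_combination h
  have := congrArg ev key
  rcases Nat.eq_zero_or_pos (l + j) with h0 | h0
  · obtain ⟨rfl, rfl⟩ : l = 0 ∧ j = 0 := by omega
    simpa [ev_coord, hU] using this.symm
  · rw [map_mul, map_pow, PowerSeries.constantCoeff_X, zero_pow h0.ne', zero_mul] at this
    simpa [hU] using this.symm

theorem LocalSystem.dvd_or_ev_eq (hc : c ≠ 0)
    (h : LocalSystem c (m + 1) (m + 1) F₀ F₁ F₂ F₃ F₄ F₅) (h0 : ev F₀ ≠ 0) (h2 : ev F₂ ≠ 0)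
    (h3 : ev F₃ ≠ 0) (h5 : ev F₅ ≠ 0) (h4 : ev F₄ = 0) :
    𝐗 ^ (m + 2) ∣ F₄ ∨ 2 * ev F₂ = 3 * (m + 1) * 0 ^ m := by
  obtain ⟨x, y, Z, hx, hy, hZ, -, ey, hsum⟩ := h.exists_pair_sums hc h0 h2 h3 h5
  have sa := h.ev_sum_even
  obtain ⟨H, rfl⟩ := PowerSeries.X_dvd_iff.mpr h4
  rw [or_iff_not_imp_left, pow_succ', mul_dvd_mul_iff_left PowerSeries.X_ne_zero]
  intro hH
  have hA := h.ev_relation h0 hy hZ ey rfl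
  have hB : logTerm c (m + 1) F₅ F₀ F₂ F₃ = 𝐗 ^ (m + 1) * (4 * y * (𝐗 ^ m * coord c - H)
      - 4 * (2 * coord c - Z) * F₂ + 2 * coord c * (F₂ - F₀)) := by
    have := h.sum_even
    rw [logTerm]
    linear_combination 4 * F₀ * hy - 4 * F₂ * hx + 4 * 𝐗 ^ m * y * this - 4 * 𝐗 ^ m * F₂ * hsum
  have := h.ode₄.ev_logTerm_quotient_eq_zero hB hH
  simp only [ev_coord, map_ofNat, map_mul, map_add, map_sub, map_pow,
    PowerSeries.constantCoeff_X, ey, zero_mul, add_zero] at this sa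
  apply mul_left_cancel₀ hc
  linear_combination hA - this - 2 * c * sa

theorem LocalSystem.simplePoles_of_ev_eq_zero (hc : c ≠ 0)
    (h : LocalSystem c (m + 1) (n + 1) F₀ F₁ F₂ F₃ F₄ F₅) (h0 : ev F₀ ≠ 0) (h2 : ev F₂ ≠ 0)
    (h3 : ev F₃ ≠ 0) (h5 : ev F₅ ≠ 0) (h4 : ev F₄ = 0) (h1 : ev F₁ = 0) :
    SimplePoles (m + 1) F₀ F₂ F₄ ∧ SimplePoles (n + 1) F₁ F₃ F₅ := by
  have hr := h.rotate.rotate.rotate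
  obtain rfl : m = n := le_antisymm (hr.odd_order_le hc h3 h0 h2 h4)
    (h.odd_order_le hc h0 h3 h5 h1)
  have sa := h.ev_sum_even
  have sb := h.rotate.ev_sum_even
  obtain ⟨x, y, Z, hx, hy, hZ, -, ey, -⟩ := h.exists_pair_sums hc h0 h2 h3 h5
  have hsum := congrArg ev hy
  simp only [map_add, map_mul, map_pow, PowerSeries.constantCoeff_X, ey] at hsum
  have hcases : 2 * ev F₂ = 3 * (m + 1) * 0 ^ m ∨ 2 * ev F₅ = 3 * (m + 1) * 0 ^ m ∨
      2 * ev F₂ = (m + 1) * 0 ^ m := by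
    rcases h.dvd_or_ev_eq hc h0 h2 h3 h5 h4 with d4 | d4
    · rcases hr.dvd_or_ev_eq hc h3 h5 h0 h2 h1 with d1 | d1
      · right; right
        have hdZ : 𝐗 ∣ Z := by
          have := dvd_add d1 d4
          rwa [hZ, pow_succ, mul_dvd_mul_iff_left (pow_ne_zero _ PowerSeries.X_ne_zero)] at this
        obtain ⟨H, hH⟩ := d4
        have hA := h.ev_relation h0 hy hZ ey (H := 𝐗 ^ (m + 1) * H)
          (by rw [hH]; ring)
        simp only [PowerSeries.X_dvd_iff.mp hdZ, map_mul, map_pow, PowerSeries.constantCoeff_X,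
          pow_succ, mul_zero, zero_mul] at hA
        apply mul_left_cancel₀ hc
        linear_combination -hA
      · exact Or.inr (Or.inl d1)
    · exact Or.inl d4
  rcases m with _ | m
  · simp only [pow_zero, Nat.cast_zero] at hcases hsum
    have a0 : ev F₀ = -ev F₂ := by linear_combination sa - h4
    have a3 : ev F₃ = -(1 - ev F₂) := by linear_combination sb - h1 - hsum
    have a5 : ev F₅ = 1 - ev F₂ := by linear_combination hsum
    have a2 : ev F₂ = 3 / 2 ∨ ev F₂ = -(1 / 2) ∨ ev F₂ = 1 / 2 := by
      rcases hcases with k | k | k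
      · exact Or.inl (by linear_combination k / 2)
      · exact Or.inr (Or.inl (by linear_combination -k / 2 + a5))
      · exact Or.inr (Or.inr (by linear_combination k / 2))
    simp only [SimplePoles, IsHalf, a0, a3, a5, h4, h1]
    rcases a2 with k | k | k <;> rw [k] <;> norm_num
  · simp [h2, h5] at hcases

theorem leading_coefficients_dichotomy {a₀ a₂ a₄ b₁ b₃ b₅ : ℂ} (ha : a₀ + a₂ + a₄ = 0)
    (hb : b₁ + b₃ + b₅ = 0) (hna : a₀ ≠ 0 ∨ a₂ ≠ 0 ∨ a₄ ≠ 0) (hnb : b₁ ≠ 0 ∨ b₃ ≠ 0 ∨ b₅ ≠ 0)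
    (h₀ : a₀ * (b₁ * a₂ - b₅ * a₄) = 0) (h₂ : a₂ * (b₃ * a₄ - b₁ * a₀) = 0) :
    (a₀ ≠ 0 ∧ a₂ ≠ 0 ∧ a₄ ≠ 0 ∧ b₁ ≠ 0 ∧ b₃ ≠ 0 ∧ b₅ ≠ 0) ∨
      (a₀ ≠ 0 ∧ a₂ ≠ 0 ∧ b₃ ≠ 0 ∧ b₅ ≠ 0 ∧ a₄ = 0 ∧ b₁ = 0) ∨
      (a₂ ≠ 0 ∧ a₄ ≠ 0 ∧ b₅ ≠ 0 ∧ b₁ ≠ 0 ∧ a₀ = 0 ∧ b₃ = 0) ∨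
      (a₄ ≠ 0 ∧ a₀ ≠ 0 ∧ b₁ ≠ 0 ∧ b₃ ≠ 0 ∧ a₂ = 0 ∧ b₅ = 0) := by
  by_cases z₄ : a₄ = 0
  · grind
  by_cases z₀ : a₀ = 0
  · grind
  by_cases z₂ : a₂ = 0
  · grind
  simp only [mul_eq_zero, z₀, z₂, false_or, sub_eq_zero] at h₀ h₂
  by_cases y₁ : b₁ = 0
  · simp_all
  by_cases y₃ : b₃ = 0
  · simp_all
  by_cases y₅ : b₅ = 0
  · simp_all
  exact Or.inl ⟨z₀, z₂, z₄, y₁, y₃, y₅⟩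

theorem SimplePoles.rotate (h : SimplePoles m F₀ F₂ F₄) : SimplePoles m F₂ F₄ F₀ :=
  h.imp_right fun ⟨hm, h0, h2, h4⟩ => ⟨hm, h2, h4, h0⟩

theorem LocalSystem.simplePoles (hc : c ≠ 0) (h : LocalSystem c m n F₀ F₁ F₂ F₃ F₄ F₅)
    (he : m = 0 ∨ ev F₀ ≠ 0 ∨ ev F₂ ≠ 0 ∨ ev F₄ ≠ 0)
    (ho : n = 0 ∨ ev F₁ ≠ 0 ∨ ev F₃ ≠ 0 ∨ ev F₅ ≠ 0) :
    SimplePoles m F₀ F₂ F₄ ∧ SimplePoles n F₁ F₃ F₅ := by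
  rcases m with _ | m <;> rcases n with _ | n
  · exact ⟨Or.inl rfl, Or.inl rfl⟩
  · obtain ⟨rfl, hI⟩ := h.rotate.simplePoles_of_odd_regular hc (by simpa using ho)
    exact ⟨Or.inl rfl, Or.inr ⟨rfl, hI⟩⟩
  · obtain ⟨rfl, hI⟩ := h.simplePoles_of_odd_regular hc (by simpa using he)
    exact ⟨Or.inr ⟨rfl, hI⟩, Or.inl rfl⟩
  have he := he.resolve_left (Nat.succ_ne_zero m)
  have ho := ho.resolve_left (Nat.succ_ne_zero n)
  have sa := h.ev_sum_even
  have sb := h.rotate.ev_sum_even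
  have e0 := h.ode₀.leading (k := m + n + 1) (by omega)
  have e2 := h.ode₂.leading (k := m + n + 1) (by omega)
  simp only [pow_succ, mul_zero, zero_mul, add_zero] at e0 e2
  rcases leading_coefficients_dichotomy sa sb he ho (by linear_combination -e0 / 4)
    (by linear_combination -e2 / 4) with
    ⟨h0, h2, h4, h1, h3, h5⟩ | ⟨h0, h2, h3, h5, h4, h1⟩ | ⟨h2, h4, h5, h1, h0, h3⟩ |
      ⟨h4, h0, h1, h3, h2, h5⟩
  · have k := h.ev_eq_of_all_leading_ne_zero hc h0 h2 h4 h1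
    have k' := h.rotate.rotate.rotate.ev_eq_of_all_leading_ne_zero hc h3 h5 h1 h4
    exact absurd (by linear_combination (2 * k' - k) / 3) h4
  · exact h.simplePoles_of_ev_eq_zero hc h0 h2 h3 h5 h4 h1
  · have := h.rotate.rotate.simplePoles_of_ev_eq_zero hc h2 h4 h5 h1 h0 h3
    exact ⟨this.1.rotate.rotate, this.2.rotate.rotate⟩
  · have := h.rotate.rotate.rotate.rotate.simplePoles_of_ev_eq_zero hc h4 h0 h1 h3 h2 h5
    exact ⟨this.1.rotate, this.2.rotate⟩

theorem LocalOde.of_X_mul (h : LocalOde c (m + 1) n (𝐗 * F₀) F₁ (𝐗 * F₂) (𝐗 * F₄) F₅) :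
    LocalOde c m n F₀ F₁ F₂ F₄ F₅ := by
  obtain ⟨α, κ, h⟩ := h
  refine ⟨α, κ, ?_⟩
  apply mul_left_cancel₀ (pow_ne_zero 2 (PowerSeries.X_ne_zero (R := ℂ)))
  simp only [Derivation.leibniz, PowerSeries.derivative_X, smul_eq_mul, logTerm] at h ⊢
  push_cast at h
  linear_combination h

theorem LocalOde.of_X_mul_coeff (h : LocalOde c m (n + 1) F₀ (𝐗 * F₁) F₂ F₄ (𝐗 * F₅)) :
    LocalOde c m n F₀ F₁ F₂ F₄ F₅ := by
  obtain ⟨α, κ, h⟩ := h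
  refine ⟨α, κ, ?_⟩
  apply mul_left_cancel₀ (PowerSeries.X_ne_zero (R := ℂ))
  simp only [logTerm] at h ⊢
  linear_combination h

theorem LocalSystem.reduce_even (h : LocalSystem c m n F₀ F₁ F₂ F₃ F₄ F₅) :
    ∃ k G₀ G₂ G₄, LocalSystem c k n G₀ F₁ G₂ F₃ G₄ F₅ ∧
      (k = 0 ∨ ev G₀ ≠ 0 ∨ ev G₂ ≠ 0 ∨ ev G₄ ≠ 0) ∧
      𝐗 ^ k * F₀ = 𝐗 ^ m * G₀ ∧ 𝐗 ^ k * F₂ = 𝐗 ^ m * G₂ ∧ 𝐗 ^ k * F₄ = 𝐗 ^ m * G₄ := by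
  induction m generalizing F₀ F₂ F₄ with
  | zero => exact ⟨0, _, _, _, h, Or.inl rfl, rfl, rfl, rfl⟩
  | succ m ih =>
    by_cases hne : ev F₀ ≠ 0 ∨ ev F₂ ≠ 0 ∨ ev F₄ ≠ 0
    · exact ⟨_, _, _, _, h, Or.inr hne, rfl, rfl, rfl⟩
    push Not at hne
    obtain ⟨z0, z2, z4⟩ := hne
    obtain ⟨F₀, rfl⟩ := PowerSeries.X_dvd_iff.mpr z0
    obtain ⟨F₂, rfl⟩ := PowerSeries.X_dvd_iff.mpr z2
    obtain ⟨F₄, rfl⟩ := PowerSeries.X_dvd_iff.mpr z4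
    obtain ⟨k, G₀, G₂, G₄, hs, hG, g0, g2, g4⟩ := ih (F₀ := F₀) (F₂ := F₂) (F₄ := F₄)
      ⟨by
        apply mul_left_cancel₀ (PowerSeries.X_ne_zero (R := ℂ))
        linear_combination h.sum_even, h.sum_odd, h.ode₀.of_X_mul, h.ode₁.of_X_mul_coeff,
        h.ode₂.of_X_mul, h.ode₃.of_X_mul_coeff, h.ode₄.of_X_mul, h.ode₅.of_X_mul_coeff⟩
    exact ⟨k, G₀, G₂, G₄, hs, hG, by linear_combination 𝐗 * g0, by linear_combination 𝐗 * g2,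
      by linear_combination 𝐗 * g4⟩

theorem SimplePoles.exists_residue {N : ℕ} {A₀ : PowerSeries ℂ}
    (h : SimplePoles m F₀ F₂ F₄) (h0 : 𝐗 ^ m * A₀ = 𝐗 ^ N * F₀) :
    ∃ G, 𝐗 * A₀ = 𝐗 ^ N * G ∧ IsHalf (ev G) := by
  rcases h with rfl | ⟨rfl, hI, -⟩
  · exact ⟨𝐗 * F₀, by linear_combination 𝐗 * h0, by simp [IsHalf]⟩
  · exact ⟨F₀, by linear_combination h0, hI⟩

theorem LocalSystem.exists_residue (hc : c ≠ 0) (h : LocalSystem c m m F₀ F₁ F₂ F₃ F₄ F₅) :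
    ∃ G, 𝐗 * F₀ = 𝐗 ^ m * G ∧ IsHalf (ev G) := by
  obtain ⟨k, G₀, G₂, G₄, hs, hG, g0, -, -⟩ := h.reduce_even
  obtain ⟨l, G₁, G₃, G₅, hs', hG', -⟩ := hs.rotate.reduce_even
  exact (hs'.rotate.rotate.rotate.rotate.rotate.simplePoles hc hG hG').1.exists_residue g0

theorem LocalOde.of_common_denominator {N : ℕ} {u : PowerSeries ℂ} {α κ : ℂ} (hu : u ≠ 0)
    (he : F₀ + F₂ + F₄ = 𝐗 ^ N * coord c) (ho : F₁ + F₃ + F₅ = 𝐗 ^ N * coord c)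
    (h : coord c * (∂ (u * F₀) * (𝐗 ^ N * u) - u * F₀ * ∂ (𝐗 ^ N * u)) * (𝐗 ^ N * u) =
      2 * (u * F₀) * ((u * F₁) * (u * F₂) + (u * F₁) * (u * F₄) + (u * F₃) * (u * F₄)
        - (u * F₂) * (u * F₃) - (u * F₂) * (u * F₅) - (u * F₄) * (u * F₅))
      + PowerSeries.C κ * (u * F₀) * (𝐗 ^ N * u) ^ 2
      + PowerSeries.C α * (u * F₂ + u * F₄) * (𝐗 ^ N * u) ^ 2) :
    LocalOde c N N F₀ F₁ F₂ F₄ F₅ := by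
  have hd : 𝐗 * ∂ (𝐗 ^ N * u) = (N : PowerSeries ℂ) * 𝐗 ^ N * u + 𝐗 ^ (N + 1) * ∂ u := by
    rcases N with _ | N
    · simp
    · simp [Derivation.leibniz]; ring
  have hd' : ∂ (u * F₀) = u * ∂ F₀ + F₀ * ∂ u := by simp [Derivation.leibniz]
  refine ⟨α, κ - α, ?_⟩
  apply mul_left_cancel₀ (pow_ne_zero 3 hu)
  rw [hd'] at h
  rw [logTerm, map_sub]
  linear_combination 𝐗 * h + coord c * u * F₀ * 𝐗 ^ N * u * hd
    + PowerSeries.C α * 𝐗 * u ^ 3 * 𝐗 ^ (2 * N) * he + 2 * 𝐗 * u ^ 3 * F₀ * (F₄ - F₂) * ho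

theorem polynomial_eq_of_eval_eq {A B q : ℂ[X]} (hq : q ≠ 0)
    (h : ∀ t, q.eval t ≠ 0 → A.eval t = B.eval t) : A = B := by
  apply mul_left_cancel₀ hq
  refine Polynomial.funext fun t => ?_
  rw [eval_mul, eval_mul]
  by_cases ht : q.eval t = 0
  · simp [ht]
  · rw [h t ht]

theorem exists_common_denominator (f : Fin 6 → RatFunc ℂ) :
    ∃ (q : ℂ[X]) (p : Fin 6 → ℂ[X]), q ≠ 0 ∧
      (∀ i, algebraMap ℂ[X] (RatFunc ℂ) (p i) = algebraMap ℂ[X] (RatFunc ℂ) q * f i) ∧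
      (∀ t, q.eval t ≠ 0 → ∀ i, DefinedAt (f i) t) ∧
      ∀ t, q.eval t ≠ 0 → ∀ i, evalR (f i) t = (p i).eval t / q.eval t := by
  have hd : ∀ i, (f i).denom ∣ ∏ k, (f k).denom := fun i =>
    Finset.dvd_prod_of_mem _ (Finset.mem_univ i)
  choose r hr using hd
  have hdef : ∀ t, (∏ k, (f k).denom).eval t ≠ 0 → ∀ i, DefinedAt (f i) t := by
    intro t ht i h0
    rw [hr i, eval_mul, h0, zero_mul] at ht
    exact ht rfl
  refine ⟨∏ k, (f k).denom, fun i => (f i).num * r i,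
    Finset.prod_ne_zero_iff.mpr fun i _ => (f i).denom_ne_zero, fun i => ?_, hdef, ?_⟩
  · have h0 : algebraMap ℂ[X] (RatFunc ℂ) (f i).denom ≠ 0 :=
      RatFunc.algebraMap_ne_zero (f i).denom_ne_zero
    have h1 := (f i).num_div_denom
    rw [div_eq_iff h0] at h1
    rw [hr i, map_mul, map_mul, h1]
    ring
  · intro t ht i
    have h0 := hdef t ht i
    rw [hr i, eval_mul] at ht ⊢
    have h1 : (r i).eval t ≠ 0 := right_ne_zero_of_mul ht
    rw [eval_mul, mul_div_mul_right _ _ h1]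
    simp [evalR, RatFunc.eval, eval₂_id]

/-- The Painlevé equation with index `i`, cleared of the common denominator `q`. -/
theorem IsA5Solution.polynomial_ode {α : Fin 6 → ℂ} {f : Fin 6 → RatFunc ℂ}
    (hsol : IsA5Solution α f) {q : ℂ[X]} {p : Fin 6 → ℂ[X]} (hq : q ≠ 0)
    (hdef : ∀ t, q.eval t ≠ 0 → ∀ i, DefinedAt (f i) t)
    (hev : ∀ t, q.eval t ≠ 0 → ∀ i, evalR (f i) t = (p i).eval t / q.eval t) (i : Fin 6) :
    X * (derivative (p i) * q - p i * derivative q) * q =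
      2 * p i * (p (i + 1) * p (i + 2) + p (i + 1) * p (i + 4) + p (i + 3) * p (i + 4)
        - p (i + 2) * p (i + 3) - p (i + 2) * p (i + 5) - p (i + 4) * p (i + 5))
      + C (1 - 2 * α (i + 2) - 2 * α (i + 4)) * p i * q ^ 2
      + C (2 * α i) * (p (i + 2) + p (i + 4)) * q ^ 2 := by
  refine polynomial_eq_of_eval_eq hq fun t ht => ?_
  have hderiv : deriv (evalR (f i)) t =
      ((derivative (p i)).eval t * q.eval t - (p i).eval t * (derivative q).eval t)
        / q.eval t ^ 2 := by
    have heq : evalR (f i) =ᶠ[𝓝 t] fun s => (p i).eval s / q.eval s := by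
      filter_upwards [q.continuous.continuousAt.eventually_ne ht] with s hs using hev s hs i
    rw [heq.deriv_eq]
    exact (((p i).hasDerivAt t).div (q.hasDerivAt t) ht).deriv
  have h := hsol.2.2 t (hdef t ht) i
  simp only [hderiv, hev t ht] at h
  simp only [eval_add, eval_sub, eval_mul, eval_pow, eval_X, eval_C, eval_ofNat]
  field_simp at h
  linear_combination h

theorem tendsto_sub_mul_of_eq_X_mul {f : RatFunc ℂ} {q P q₁ : ℂ[X]} {G : PowerSeries ℂ} {N : ℕ}
    (hev : ∀ t, q.eval t ≠ 0 → evalR f t = P.eval (t - c) / q.eval t)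
    (hq : ∀ t, q.eval t = (t - c) ^ N * q₁.eval (t - c)) (hq₁ : q₁.eval 0 ≠ 0)
    (hG : 𝐗 * (P : PowerSeries ℂ) = 𝐗 ^ N * (q₁ * G)) :
    Tendsto (fun t => (t - c) * evalR f t) (𝓝[≠] c) (𝓝 (ev G)) ∧
      (PoleAt f c → ev G ≠ 0) := by
  have hcoe : ∀ A : ℂ[X], ev (A : PowerSeries ℂ) = A.eval 0 := fun A => by
    rw [← PowerSeries.coeff_zero_eq_constantCoeff_apply, Polynomial.coeff_coe,
      Polynomial.coeff_zero_eq_eval_zero]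
  obtain ⟨P₁, hP₁⟩ : (X : ℂ[X]) ^ N ∣ X * P := by
    rw [Polynomial.X_pow_dvd_iff]
    intro d hd
    have := PowerSeries.X_pow_dvd_iff.mp ⟨_, hG⟩ d hd
    rwa [← Polynomial.coe_X, ← Polynomial.coe_mul, Polynomial.coeff_coe] at this
  have hP₁G : (P₁ : PowerSeries ℂ) = q₁ * G := by
    apply mul_left_cancel₀ (pow_ne_zero N (PowerSeries.X_ne_zero (R := ℂ)))
    rw [← hG, ← Polynomial.coe_X, ← Polynomial.coe_mul, hP₁]
    simp
  have hval : P₁.eval 0 = q₁.eval 0 * ev G := by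
    rw [← hcoe, ← hcoe, ← map_mul, hP₁G]
  have hcont : ∀ A : ℂ[X], Tendsto (fun t => A.eval (t - c)) (𝓝[≠] c) (𝓝 (A.eval 0)) := by
    intro A
    have : Continuous fun t => A.eval (t - c) :=
      A.continuous.comp (continuous_id.sub continuous_const)
    simpa using this.continuousAt.tendsto.mono_left (nhdsWithin_le_nhds (a := c) (s := {c}ᶜ))
  have hne : ∀ᶠ t in 𝓝[≠] c, t - c ≠ 0 ∧ q₁.eval (t - c) ≠ 0 := by
    filter_upwards [self_mem_nhdsWithin, (hcont q₁).eventually_ne hq₁] with t h1 h2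
    exact ⟨sub_ne_zero.mpr h1, h2⟩
  have hquot : ∀ᶠ t in 𝓝[≠] c, P₁.eval (t - c) / q₁.eval (t - c) = (t - c) * evalR f t := by
    filter_upwards [hne] with t ⟨h1, h2⟩
    have h3 := congrArg (eval (t - c)) hP₁
    simp only [eval_mul, eval_pow, eval_X] at h3
    rw [hev t (by rw [hq]; exact mul_ne_zero (pow_ne_zero _ h1) h2), hq, mul_div_assoc', h3,
      mul_div_mul_left _ _ (pow_ne_zero _ h1)]
  refine ⟨?_, fun hp h0 => ?_⟩
  · refine Tendsto.congr' hquot ?_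
    have h := (hcont P₁).div (hcont q₁) hq₁
    rw [hval, mul_div_cancel_left₀ _ hq₁] at h
    exact h
  · obtain ⟨P₂, rfl⟩ : X ∣ P₁ := by
      rw [Polynomial.X_dvd_iff, Polynomial.coeff_zero_eq_eval_zero, hval, h0, mul_zero]
    refine not_tendsto_nhds_of_tendsto_atTop hp _
      (Tendsto.norm (Tendsto.congr' ?_ ((hcont P₂).div (hcont q₁) hq₁)))
    filter_upwards [hne, hquot] with t ⟨h1, _⟩ h3
    apply mul_left_cancel₀ h1
    rw [← h3, eval_mul, eval_X, Pi.div_apply, mul_div_assoc]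

/-- Any pole of a component of a rational solution at a nonzero point `c` is simple
with residue a half-integer in `{-3/2, -1/2, 1/2, 3/2}`. -/
theorem stmt_16 (α : Fin 6 → ℂ) (f : Fin 6 → RatFunc ℂ)
    (hsum : α 0 + α 1 + α 2 + α 3 + α 4 + α 5 = 1)
    (hsol : IsA5Solution α f)
    (j : Fin 6) (c : ℂ) (hc : c ≠ 0) (hp : PoleAt (f j) c) :
    ∃ r : ℂ, Tendsto (fun t => (t - c) * evalR (f j) t) (𝓝[≠] c) (𝓝 r) ∧
      (r = -(3 / 2) ∨ r = -(1 / 2) ∨ r = 1 / 2 ∨ r = 3 / 2) := by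
  obtain ⟨q, p, hq, hpf, hdef, hev⟩ := exists_common_denominator f
  have hode := hsol.polynomial_ode hq hdef hev
  obtain ⟨q₁, hqq, hq₁⟩ := exists_eq_pow_rootMultiplicity_mul_and_not_dvd q hq c
  set N := q.rootMultiplicity c
  let σ : ℂ[X] →+* PowerSeries ℂ := (Polynomial.coeToPowerSeries.ringHom).comp
    (Polynomial.compRingHom (X + C c))
  have hσ : ∀ A, σ A = ((A.comp (X + C c) : ℂ[X]) : PowerSeries ℂ) := fun A => rfl
  have hσd : ∀ A, ∂ (σ A) = σ (derivative A) := fun A => by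
    rw [hσ, hσ, PowerSeries.derivative_coe, derivative_comp]; simp
  have hσX : σ X = coord c := by rw [hσ]; simp [coord]
  have hσC : ∀ a, σ (C a) = PowerSeries.C a := fun a => by rw [hσ]; simp
  have hu : ev (σ q₁) ≠ 0 := by
    rw [hσ, ← PowerSeries.coeff_zero_eq_constantCoeff_apply, Polynomial.coeff_coe,
      Polynomial.coeff_zero_eq_eval_zero, eval_comp]
    simpa [dvd_iff_isRoot] using hq₁
  have hu0 : σ q₁ ≠ 0 := fun h => hu (by rw [h, map_zero])
  have hσq : σ q = 𝐗 ^ N * σ q₁ := by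
    conv_lhs => rw [hqq]
    rw [map_mul, map_pow, map_sub, hσX, hσC, coord, add_sub_cancel_right]
  let F : Fin 6 → PowerSeries ℂ := fun i => (σ q₁)⁻¹ * σ (p i)
  have hF : ∀ i, σ (p i) = σ q₁ * F i := fun i => by
    rw [← mul_assoc, PowerSeries.mul_inv_cancel _ hu, one_mul]
  have hsumF : ∀ i k l, f i + f k + f l = RatFunc.X → F i + F k + F l = 𝐗 ^ N * coord c := by
    intro i k l h
    have : p i + p k + p l = q * X := by
      apply RatFunc.algebraMap_injective ℂ
      rw [map_add, map_add, map_mul, hpf, hpf, hpf, RatFunc.algebraMap_X, ← h]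
      ring
    have := congrArg σ this
    rw [map_add, map_add, map_mul, hF, hF, hF, hσq, hσX] at this
    apply mul_left_cancel₀ hu0
    linear_combination this
  have hE := hsumF 0 2 4 hsol.1
  have hO := hsumF 1 3 5 hsol.2.1
  have hloc : ∀ i, F i + F (i + 2) + F (i + 4) = 𝐗 ^ N * coord c →
      F (i + 1) + F (i + 3) + F (i + 5) = 𝐗 ^ N * coord c →
      LocalOde c N N (F i) (F (i + 1)) (F (i + 2)) (F (i + 4)) (F (i + 5)) := by
    intro i he ho
    refine LocalOde.of_common_denominator (F₃ := F (i + 3)) hu0 he ho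
      (κ := 1 - 2 * α (i + 2) - 2 * α (i + 4)) (α := 2 * α i) ?_
    have := congrArg σ (hode i)
    simp only [map_add, map_sub, map_mul, map_pow, map_ofNat, hσX, hσC, ← hσd, hσq, hF] at this
    simpa only [map_add, map_sub, map_mul, map_pow, map_ofNat] using this
  have hsys : LocalSystem c N N (F 0) (F 1) (F 2) (F 3) (F 4) (F 5) :=
    ⟨hE, hO, hloc 0 hE hO, hloc 1 hO (show F 2 + F 4 + F 0 = _ by linear_combination hE),
      hloc 2 (show F 2 + F 4 + F 0 = _ by linear_combination hE)
        (show F 3 + F 5 + F 1 = _ by linear_combination hO),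
      hloc 3 (show F 3 + F 5 + F 1 = _ by linear_combination hO)
        (show F 4 + F 0 + F 2 = _ by linear_combination hE),
      hloc 4 (show F 4 + F 0 + F 2 = _ by linear_combination hE)
        (show F 5 + F 1 + F 3 = _ by linear_combination hO),
      hloc 5 (show F 5 + F 1 + F 3 = _ by linear_combination hO) hE⟩
  obtain ⟨G, hG, hI⟩ : ∃ G, 𝐗 * F j = 𝐗 ^ N * G ∧ IsHalf (ev G) := by
    have h1 := hsys.rotate
    have h2 := h1.rotate
    have h3 := h2.rotate
    have h4 := h3.rotate
    have h5 := h4.rotate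
    fin_cases j
    exacts [hsys.exists_residue hc, h1.exists_residue hc, h2.exists_residue hc,
      h3.exists_residue hc, h4.exists_residue hc, h5.exists_residue hc]
  obtain ⟨hlim, hne⟩ := tendsto_sub_mul_of_eq_X_mul (c := c) (f := f j) (q := q)
    (P := (p j).comp (X + C c)) (q₁ := q₁.comp (X + C c)) (G := G) (N := N)
    (fun t ht => by rw [hev t ht]; simp)
    (fun t => by conv_lhs => rw [hqq]
                 simp)
    (by simpa [dvd_iff_isRoot] using hq₁)
    (by rw [← hσ, ← hσ, hF]; linear_combination σ q₁ * hG)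
  exact ⟨_, hlim, hI.resolve_left (hne hp)⟩
end
end
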